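/- There exists a real constant c with 0.6224 ≤ c ≤ 0.6420 such that f_{3,3}(n)/n converges to c as n → ∞; that is, f_{3,3}(n) = (c + o(1))·n. -/

import Mathlib

open Finset Filter

/-- The multiset of the values of `a` can be partitioned into groups,
each consisting of `d` copies of a single number. -/
def TrivialSol (d : ℕ) {k : ℕ} (a : Fin k → ℕ) : Prop :=
  ∀ y : ℕ, d ∣ (List.ofFn a : Multiset ℕ).count y

/-- `fkd k d n` is the maximum cardinality of a set `A ⊆ {1,…,n}` such that whenever
`a_1, …, a_k ∈ A` (not necessarily distinct) and `a_1 ⋯ a_k = x ^ d` for a positive integer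
`x`, the multiset of the `a_i` is trivial. -/
noncomputable def fkd (k d n : ℕ) : ℕ :=
  sSup {m : ℕ | ∃ A : Finset ℕ, A ⊆ Finset.Icc 1 n ∧ A.card = m ∧
    ∀ (a : Fin k → ℕ) (x : ℕ), (∀ i, a i ∈ A) → 0 < x →
      (∏ i, a i) = x ^ d → TrivialSol d a}

def Good (A : Finset ℕ) : Prop :=
  ∀ a ∈ A, ∀ b ∈ A, ∀ c ∈ A, ∀ x : ℕ, 0 < x → a * b * c = x ^ 3 → a = b ∧ b = c

lemma trivialSol_iff (a : Fin 3 → ℕ) : TrivialSol 3 a ↔ a 0 = a 1 ∧ a 1 = a 2 := by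
  unfold TrivialSol
  have h : (List.ofFn a : Multiset ℕ) = ([a 0, a 1, a 2] : List ℕ) := by
    simp [List.ofFn_succ]
  rw [h]
  simp only [Multiset.coe_count, List.count_cons, List.count_nil, beq_iff_eq]
  constructor
  · intro H
    have h0 := H (a 0)
    have h1 := H (a 1)
    constructor
    · by_contra hne
      have : ¬ a 1 = a 0 := fun h => hne h.symm
      simp only [this, if_true, if_false] at h0
      split_ifs at h0 <;> omega
    · by_contra hne
      have : ¬ a 2 = a 1 := fun h => hne h.symm
      simp only [this, if_true, if_false] at h1
      split_ifs at h1 <;> omega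
  · rintro ⟨h0, h1⟩ y
    rw [h0, h1]
    split_ifs <;> norm_num

lemma good_iff (A : Finset ℕ) : Good A ↔ ∀ (a : Fin 3 → ℕ) (x : ℕ), (∀ i, a i ∈ A) → 0 < x →
      (∏ i, a i) = x ^ 3 → TrivialSol 3 a := by
  constructor
  · intro h a x ha hx hp
    rw [trivialSol_iff]
    rw [Fin.prod_univ_three] at hp
    exact h _ (ha 0) _ (ha 1) _ (ha 2) x hx hp
  · intro h a ha b hb c hc x hx hp
    have := h ![a, b, c] x (by intro i; fin_cases i <;> simpa) hx
      (by rw [Fin.prod_univ_three]; simpa using hp)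
    rw [trivialSol_iff] at this
    simpa using this

lemma fkd_bdd (n : ℕ) : BddAbove {m : ℕ | ∃ A : Finset ℕ, A ⊆ Finset.Icc 1 n ∧ A.card = m ∧
    ∀ (a : Fin 3 → ℕ) (x : ℕ), (∀ i, a i ∈ A) → 0 < x →
      (∏ i, a i) = x ^ 3 → TrivialSol 3 a} := by
  refine ⟨n, ?_⟩
  rintro m ⟨A, hA, rfl, -⟩
  simpa using Finset.card_le_card hA

lemma fkd_ge {n : ℕ} {A : Finset ℕ} (hA : A ⊆ Finset.Icc 1 n) (hg : Good A) :
    A.card ≤ fkd 3 3 n :=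
  le_csSup (fkd_bdd n) ⟨A, hA, rfl, (good_iff A).1 hg⟩

lemma fkd_attain (n : ℕ) : ∃ A ⊆ Finset.Icc 1 n, Good A ∧ A.card = fkd 3 3 n := by
  have h := Nat.sSup_mem (s := {m : ℕ | ∃ A : Finset ℕ, A ⊆ Finset.Icc 1 n ∧ A.card = m ∧
    ∀ (a : Fin 3 → ℕ) (x : ℕ), (∀ i, a i ∈ A) → 0 < x →
      (∏ i, a i) = x ^ 3 → TrivialSol 3 a}) ⟨0, ∅, by simp, by simp, by
        intro a x h; exact absurd (h 0) (by simp)⟩ (fkd_bdd n)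
  obtain ⟨A, hA, hc, hg⟩ := h
  exact ⟨A, hA, (good_iff A).2 hg, hc⟩

lemma cubefree_part (a : ℕ) : 0 < a → ∃ b k : ℕ, 0 < b ∧ 0 < k ∧ a = b * k ^ 3 ∧
    ∀ m, 1 < m → ¬ m ^ 3 ∣ b := by
  induction a using Nat.strong_induction_on with
  | _ a ih =>
    intro ha
    by_cases h : ∀ m, 1 < m → ¬ m ^ 3 ∣ a
    · exact ⟨a, 1, ha, one_pos, by simp, h⟩
    · push Not at h
      obtain ⟨m, hm, c, hc⟩ := h
      have hc0 : 0 < c := by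
        rcases Nat.eq_zero_or_pos c with h | h
        · subst h; omega
        · exact h
      have h1 : 1 < m ^ 3 := Nat.one_lt_pow (by norm_num) hm
      obtain ⟨b, k, hb, hk, he, hf⟩ := ih c (by rw [hc]; nlinarith) hc0
      exact ⟨b, k * m, hb, by positivity, by rw [hc, he]; ring, hf⟩

lemma cubefree_reduce {n : ℕ} {A : Finset ℕ} (hA : A ⊆ Finset.Icc 1 n) (hg : Good A) :
    ∃ B ⊆ Finset.Icc 1 n, Good B ∧ B.card = A.card ∧ ∀ b ∈ B, ∀ m, 1 < m → ¬ m ^ 3 ∣ b := by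
  have H : ∀ a : ℕ, ∃ b k : ℕ, 0 < a → (0 < b ∧ 0 < k ∧ a = b * k ^ 3 ∧
    ∀ m, 1 < m → ¬ m ^ 3 ∣ b) := by
    intro a
    rcases Nat.eq_zero_or_pos a with h | h
    · exact ⟨0, 0, by omega⟩
    · obtain ⟨b, k, h'⟩ := cubefree_part a h
      exact ⟨b, k, fun _ => h'⟩
  choose f k H using H
  have pos : ∀ a ∈ A, 0 < a := fun a ha => (Finset.mem_Icc.1 (hA ha)).1
  have key : ∀ a ∈ A, ∀ b ∈ A, ∀ c ∈ A, ∀ x, 0 < x → f a * f b * f c = x ^ 3 → a = b ∧ b = c := by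
    intro a ha b hb c hc x hx he
    obtain ⟨a1, a2, a3, a4⟩ := H a (pos a ha)
    obtain ⟨b1, b2, b3, b4⟩ := H b (pos b hb)
    obtain ⟨c1, c2, c3, c4⟩ := H c (pos c hc)
    refine hg a ha b hb c hc (x * (k a * k b * k c)) (by positivity) ?_
    calc a * b * c = (f a * k a ^ 3) * (f b * k b ^ 3) * (f c * k c ^ 3) := by
          rw [← a3, ← b3, ← c3]
      _ = (f a * f b * f c) * (k a * k b * k c) ^ 3 := by ring
      _ = _ := by rw [he]; ring
  refine ⟨A.image f, ?_, ?_, ?_, ?_⟩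
  · intro b hb
    obtain ⟨a, ha, rfl⟩ := Finset.mem_image.1 hb
    obtain ⟨a1, a2, a3, a4⟩ := H a (pos a ha)
    have := Finset.mem_Icc.1 (hA ha)
    rw [Finset.mem_Icc]
    refine ⟨a1, le_trans ?_ this.2⟩
    calc f a ≤ f a * k a ^ 3 := Nat.le_mul_of_pos_right _ (by positivity)
      _ = a := a3.symm
  · intro a ha b hb c hc x hx he
    obtain ⟨a', ha', rfl⟩ := Finset.mem_image.1 ha
    obtain ⟨b', hb', rfl⟩ := Finset.mem_image.1 hb
    obtain ⟨c', hc', rfl⟩ := Finset.mem_image.1 hc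
    obtain ⟨h1, h2⟩ := key a' ha' b' hb' c' hc' x hx he
    rw [h1, h2]; exact ⟨rfl, rfl⟩
  · refine Finset.card_image_of_injOn ?_
    intro a ha b hb he
    exact (key a ha a ha b hb (f a) (H a (pos a ha)).1 (by
      have he' : f a = f b := he
      rw [← he']; ring)).2
  · intro b hb
    obtain ⟨a, ha, rfl⟩ := Finset.mem_image.1 hb
    exact (H a (pos a ha)).2.2.2

open Classical in
noncomputable def gN (N y : ℕ) : ℕ :=
  (((N ^ 2).divisors.filter (· ≤ y)).powerset.filter Good).sup Finset.card

lemma gN_ge {N y : ℕ} {A : Finset ℕ} (hA : A ⊆ (N ^ 2).divisors) (hy : ∀ a ∈ A, a ≤ y)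
    (hg : Good A) : A.card ≤ gN N y := by
  classical
  unfold gN
  refine Finset.le_sup (f := Finset.card) ?_
  rw [Finset.mem_filter, Finset.mem_powerset]
  exact ⟨fun a ha => Finset.mem_filter.2 ⟨hA ha, hy a ha⟩, hg⟩

lemma gN_attain (N y : ℕ) : ∃ A ⊆ (N ^ 2).divisors, (∀ a ∈ A, a ≤ y) ∧ Good A ∧
    A.card = gN N y := by
  classical
  obtain ⟨A, hA, he⟩ := Finset.exists_mem_eq_sup
    (((N ^ 2).divisors.filter (· ≤ y)).powerset.filter Good)
    ⟨∅, by simp [Good]⟩ Finset.card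
  rw [Finset.mem_filter, Finset.mem_powerset] at hA
  exact ⟨A, fun a ha => (Finset.mem_filter.1 (hA.1 ha)).1,
    fun a ha => (Finset.mem_filter.1 (hA.1 ha)).2, hA.2, by unfold gN; rw [he]⟩

/-- sieve condition -/
def RR (I : Finset ℕ) (d : ℕ → ℕ) (r : ℕ) : Prop := ∀ p ∈ I, ¬ d p ∣ r

instance (I : Finset ℕ) (d : ℕ → ℕ) : DecidablePred (RR I d) := fun r => by
  unfold RR; infer_instance

lemma rough_coprime {N b : ℕ} (hb : 0 < b) (hcf : ∀ m, 1 < m → ¬ m ^ 3 ∣ b) :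
    Nat.Coprime (b / Nat.gcd b (N ^ 2)) N := by
  by_contra h
  obtain ⟨p, hp, h1, h2⟩ := Nat.Prime.not_coprime_iff_dvd.1 h
  set s := Nat.gcd b (N ^ 2) with hs
  have hsb : s ∣ b := Nat.gcd_dvd_left _ _
  have hb' : s * (b / s) = b := Nat.mul_div_cancel' hsb
  have hpb : p ∣ b := h1.trans (Nat.div_dvd_of_dvd hsb)
  have hps : p ∣ s := Nat.dvd_gcd hpb (h2.trans (dvd_pow_self _ (by norm_num)))
  have hp2 : p ^ 2 ∣ b := by
    rw [← hb', pow_two]; exact mul_dvd_mul hps h1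
  have hps2 : p ^ 2 ∣ s := Nat.dvd_gcd hp2 (pow_dvd_pow_of_dvd h2 2)
  apply hcf p hp.one_lt
  rw [← hb', pow_succ]; exact mul_dvd_mul hps2 h1

lemma upper (N : ℕ) (hN : 0 < N) (I : Finset ℕ) (d : ℕ → ℕ)
    (hd : ∀ p ∈ I, ((d p).Prime ∧ d p ∣ N) ∨ ∃ m, 1 < m ∧ d p = m ^ 3) (n : ℕ) :
    fkd 3 3 n ≤ ∑ r ∈ (Finset.Icc 1 n).filter (RR I d), gN N (n / r) := by
  obtain ⟨A, hA, hg, hc⟩ := fkd_attain n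
  obtain ⟨B, hB, hgB, hcB, hcf⟩ := cubefree_reduce hA hg
  rw [← hc, ← hcB]
  have pos : ∀ b ∈ B, 0 < b := fun a ha => (Finset.mem_Icc.1 (hB ha)).1
  have hmul : ∀ b, Nat.gcd b (N ^ 2) * (b / Nat.gcd b (N ^ 2)) = b := fun b =>
    Nat.mul_div_cancel' (Nat.gcd_dvd_left _ _)
  have hmaps : ∀ b ∈ B, b / Nat.gcd b (N ^ 2) ∈ (Finset.Icc 1 n).filter (RR I d) := by
    intro b hb
    rw [Finset.mem_filter, Finset.mem_Icc]
    have hb0 := pos b hb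
    have hs0 : 0 < Nat.gcd b (N ^ 2) := Nat.gcd_pos_of_pos_left _ hb0
    refine ⟨⟨Nat.div_pos (Nat.le_of_dvd hb0 (Nat.gcd_dvd_left _ _)) hs0,
      (Nat.div_le_self _ _).trans (Finset.mem_Icc.1 (hB hb)).2⟩, ?_⟩
    intro p hp hdiv
    rcases hd p hp with ⟨hpr, hpN⟩ | ⟨m, hm, he⟩
    · have := rough_coprime (N := N) hb0 (hcf b hb)
      exact hpr.one_lt.ne' (Nat.eq_one_of_dvd_coprimes this hdiv hpN)
    · exact hcf b hb m hm (he ▸ hdiv.trans (Nat.div_dvd_of_dvd (Nat.gcd_dvd_left _ _)))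
  rw [Finset.card_eq_sum_card_fiberwise hmaps]
  refine Finset.sum_le_sum ?_
  intro r hr
  rw [Finset.mem_filter, Finset.mem_Icc] at hr
  have hfib : ∀ b ∈ B.filter (fun b => b / Nat.gcd b (N ^ 2) = r),
      b ∈ B ∧ Nat.gcd b (N ^ 2) * r = b := by
    intro b hb
    rw [Finset.mem_filter] at hb
    exact ⟨hb.1, by have := hmul b; rwa [hb.2] at this⟩
  rw [← Finset.card_image_of_injOn (f := fun b => Nat.gcd b (N ^ 2))]
  · apply gN_ge
    · intro s hs
      obtain ⟨b, hb, rfl⟩ := Finset.mem_image.1 hs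
      exact Nat.mem_divisors.2 ⟨Nat.gcd_dvd_right _ _, by positivity⟩
    · intro s hs
      obtain ⟨b, hb, rfl⟩ := Finset.mem_image.1 hs
      obtain ⟨h1, h2⟩ := hfib b hb
      rw [Nat.le_div_iff_mul_le (by omega)]
      show Nat.gcd b (N ^ 2) * r ≤ n
      rw [h2]; exact (Finset.mem_Icc.1 (hB h1)).2
    · intro s hs t ht u hu x hx he
      obtain ⟨a, ha, rfl⟩ := Finset.mem_image.1 hs
      obtain ⟨b, hb, rfl⟩ := Finset.mem_image.1 ht
      obtain ⟨c, hc, rfl⟩ := Finset.mem_image.1 hu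
      obtain ⟨h1, h2⟩ := hfib a ha
      obtain ⟨h3, h4⟩ := hfib b hb
      obtain ⟨h5, h6⟩ := hfib c hc
      have hr0 : 0 < r := by omega
      have := hgB a h1 b h3 c h5 (x * r) (by positivity) (by
        calc a * b * c = (Nat.gcd a (N ^ 2) * r) * (Nat.gcd b (N ^ 2) * r) *
              (Nat.gcd c (N ^ 2) * r) := by rw [h2, h4, h6]
          _ = (Nat.gcd a (N ^ 2) * Nat.gcd b (N ^ 2) * Nat.gcd c (N ^ 2)) * r ^ 3 := by ring
          _ = _ := by rw [he]; ring)
      rw [this.1, this.2]; exact ⟨rfl, rfl⟩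
  · intro a ha b hb he
    obtain ⟨h1, h2⟩ := hfib a ha
    obtain ⟨h3, h4⟩ := hfib b hb
    have he' : Nat.gcd a (N ^ 2) = Nat.gcd b (N ^ 2) := he
    rw [← h2, ← h4, he']

lemma sqfree_cube {a b c z : ℕ} (ha : Squarefree a) (hb : Squarefree b) (hc : Squarefree c)
    (h : a * b * c = z ^ 3) : a = b ∧ b = c := by
  have a0 := ha.ne_zero
  have b0 := hb.ne_zero
  have c0 := hc.ne_zero
  have key : ∀ p, a.factorization p = b.factorization p ∧
      b.factorization p = c.factorization p := by
    intro p
    have h1 := ha.natFactorization_le_one p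
    have h2 := hb.natFactorization_le_one p
    have h3 := hc.natFactorization_le_one p
    have := congrArg (fun m => m.factorization p) h
    simp only [Nat.factorization_mul (mul_ne_zero a0 b0) c0, Nat.factorization_mul a0 b0,
      Nat.factorization_pow, Finsupp.add_apply, Finsupp.smul_apply, smul_eq_mul] at this
    omega
  exact ⟨Nat.eq_of_factorization_eq a0 b0 fun p => (key p).1,
    Nat.eq_of_factorization_eq b0 c0 fun p => (key p).2⟩

lemma lower (N Q : ℕ) (hN : 0 < N) (I : Finset ℕ) (d : ℕ → ℕ)
    (hd : ∀ r, RR I d r → Nat.Coprime r N ∧ ∀ p : ℕ, p.Prime → p * p ∣ r → Q < p) (n : ℕ) :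
    ∑ r ∈ (Finset.Icc 1 n).filter (RR I d), gN N (n / r) ≤
      fkd 3 3 n + ((Finset.Icc 1 n).filter (fun a => ∃ m ∈ Finset.Ioc Q n, m ^ 2 ∣ a)).card := by
  choose A hA hy hg hc using fun y => gN_attain N y
  set S := (Finset.Icc 1 n).filter (RR I d) with hS
  set P := S.sigma (fun r => A (n / r)) with hP
  have hPm : ∀ q ∈ P, 0 < q.1 ∧ RR I d q.1 ∧ q.2 ∈ A (n / q.1) ∧ 0 < q.2 ∧ q.1 * q.2 ≤ n ∧
      Nat.Coprime q.1 N ∧ q.2 ∣ N ^ 2 := by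
    intro q hq
    rw [hP, Finset.mem_sigma, hS, Finset.mem_filter, Finset.mem_Icc] at hq
    obtain ⟨⟨⟨h1, h2⟩, h3⟩, h4⟩ := hq
    have h5 := Nat.dvd_of_mem_divisors (hA _ h4)
    have h6 := hy _ _ h4
    rw [Nat.le_div_iff_mul_le (by omega)] at h6
    exact ⟨h1, h3, h4, Nat.pos_of_dvd_of_pos h5 (by positivity), by rw [mul_comm]; exact h6,
      (hd _ h3).1, h5⟩
  have hgcd : ∀ q ∈ P, Nat.gcd (q.1 * q.2) (N ^ 2) = q.2 := by
    intro q hq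
    obtain ⟨-, -, -, -, -, h1, h2⟩ := hPm q hq
    rw [Nat.Coprime.gcd_mul_left_cancel _ (Nat.Coprime.pow_right 2 h1)]
    exact Nat.gcd_eq_left h2
  have hinj : Set.InjOn (fun q : (_ : ℕ) × ℕ => q.1 * q.2) P := by
    intro q hq q' hq' he
    simp only at he
    have e2 : q.2 = q'.2 := by rw [← hgcd q hq, ← hgcd q' hq', he]
    have e1 : q.1 = q'.1 := by
      rw [e2] at he
      exact Nat.eq_of_mul_eq_mul_right (hPm q' hq').2.2.2.1 he
    cases q; cases q'; simp_all
  have hcard : ∑ r ∈ S, gN N (n / r) = (P.image (fun q => q.1 * q.2)).card := by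
    rw [Finset.card_image_of_injOn hinj, hP, Finset.card_sigma]
    exact Finset.sum_congr rfl fun r _ => (hc _).symm
  rw [hcard]
  set B := P.image (fun q => q.1 * q.2) with hB
  set bad : ℕ → Prop := fun a => ∃ m ∈ Finset.Ioc Q n, m ^ 2 ∣ a with hbad
  rw [← Finset.card_filter_add_card_filter_not (s := B) (fun a => ¬ bad a)]
  have hBn : B ⊆ Finset.Icc 1 n := by
    intro b hb
    obtain ⟨q, hq, rfl⟩ := Finset.mem_image.1 hb
    obtain ⟨h1, -, -, h2, h3, -⟩ := hPm q hq
    exact Finset.mem_Icc.2 ⟨Nat.mul_pos h1 h2, h3⟩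
  refine Nat.add_le_add ?_ ?_
  · apply fkd_ge
    · exact (Finset.filter_subset _ _).trans hBn
    · have hsf : ∀ b ∈ B.filter (fun a => ¬ bad a), ∃ q ∈ P, Squarefree q.1 ∧ q.1 * q.2 = b := by
        intro b hb
        rw [Finset.mem_filter] at hb
        obtain ⟨q, hq, rfl⟩ := Finset.mem_image.1 hb.1
        refine ⟨q, hq, ?_, rfl⟩
        obtain ⟨h1, h2, h3, h4, h5, h6, h7⟩ := hPm q hq
        rw [Nat.squarefree_iff_prime_squarefree]
        intro p hp hpd
        have hQp := (hd _ h2).2 p hp hpd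
        apply hb.2
        refine ⟨p, Finset.mem_Ioc.2 ⟨hQp, ?_⟩, ?_⟩
        · have : p * p ≤ q.1 := Nat.le_of_dvd h1 hpd
          nlinarith [hp.pos]
        · rw [pow_two]; exact hpd.mul_right _
      intro a ha b hb c hc' x hx he
      obtain ⟨⟨r1, s1⟩, hq1, f1, rfl⟩ := hsf a ha
      obtain ⟨⟨r2, s2⟩, hq2, f2, rfl⟩ := hsf b hb
      obtain ⟨⟨r3, s3⟩, hq3, f3, rfl⟩ := hsf c hc'
      obtain ⟨p1, -, m1, z1, -, c1, d1⟩ := hPm _ hq1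
      obtain ⟨p2, -, m2, z2, -, c2, d2⟩ := hPm _ hq2
      obtain ⟨p3, -, m3, z3, -, c3, d3⟩ := hPm _ hq3
      simp only at *
      have hcop : Nat.Coprime (r1 * r2 * r3) (s1 * s2 * s3) := by
        have hr : Nat.Coprime (r1 * r2 * r3) (N ^ 2) :=
          (Nat.Coprime.mul_left (Nat.Coprime.mul_left c1 c2) c3).pow_right 2
        exact Nat.Coprime.mul_right (Nat.Coprime.mul_right (hr.coprime_dvd_right d1)
          (hr.coprime_dvd_right d2)) (hr.coprime_dvd_right d3)
      have he' : (r1 * r2 * r3) * (s1 * s2 * s3) = x ^ 3 := by rw [← he]; ring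
      obtain ⟨z, hz⟩ := exists_eq_pow_of_mul_eq_pow
        (Nat.isUnit_iff.2 hcop) he'
      obtain ⟨w, hw⟩ := exists_eq_pow_of_mul_eq_pow
        (Nat.isUnit_iff.2 hcop.symm) ((mul_comm _ _).trans he')
      obtain ⟨e1, e2⟩ := sqfree_cube f1 f2 f3 hz
      subst e1
      subst e2
      have hw0 : 0 < w := by
        rcases Nat.eq_zero_or_pos w with h | h
        · subst h
          have : 0 < s1 * s2 * s3 := by positivity
          simp at hw; omega
        · exact h
      obtain ⟨e3, e4⟩ := hg _ _ m1 _ m2 _ m3 w hw0 hw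
      rw [e3, e4]; exact ⟨rfl, rfl⟩
  · refine Finset.card_le_card ?_
    intro a ha
    rw [Finset.mem_filter] at ha ⊢
    exact ⟨hBn ha.1, not_not.1 ha.2⟩

lemma bad_count (Q n : ℕ) (hQ : 0 < Q) :
    (((Finset.Icc 1 n).filter (fun a => ∃ m ∈ Finset.Ioc Q n, m ^ 2 ∣ a)).card : ℝ) ≤ n / Q := by
  rcases Nat.lt_or_ge n Q with hlt | hle
  · have : Finset.Ioc Q n = ∅ := Finset.Ioc_eq_empty (by omega)
    simp only [this]
    simp
    positivity
  have h1 : ((Finset.Icc 1 n).filter (fun a => ∃ m ∈ Finset.Ioc Q n, m ^ 2 ∣ a)).card ≤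
      ∑ m ∈ Finset.Ioc Q n, n / m ^ 2 := by
    have : (Finset.Icc 1 n).filter (fun a => ∃ m ∈ Finset.Ioc Q n, m ^ 2 ∣ a) ⊆
        (Finset.Ioc Q n).biUnion (fun m => (Finset.Ioc 0 n).filter (fun a => m ^ 2 ∣ a)) := by
      intro a ha
      simp only [Finset.mem_filter, Finset.mem_biUnion, Finset.mem_Icc, Finset.mem_Ioc] at ha ⊢
      obtain ⟨⟨h1, h2⟩, m, hm, hd⟩ := ha
      exact ⟨m, hm, ⟨by omega, h2⟩, hd⟩
    refine (Finset.card_le_card this).trans (Finset.card_biUnion_le.trans ?_)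
    refine Finset.sum_le_sum fun m hm => ?_
    rw [Nat.Ioc_filter_dvd_card_eq_div]
  calc (((Finset.Icc 1 n).filter (fun a => ∃ m ∈ Finset.Ioc Q n, m ^ 2 ∣ a)).card : ℝ)
      ≤ ((∑ m ∈ Finset.Ioc Q n, n / m ^ 2 : ℕ) : ℝ) := by exact_mod_cast h1
    _ = ∑ m ∈ Finset.Ioc Q n, ((n / m ^ 2 : ℕ) : ℝ) := by push_cast; rfl
    _ ≤ ∑ m ∈ Finset.Ioc Q n, (n : ℝ) * ((m : ℝ) ^ 2)⁻¹ := by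
        refine Finset.sum_le_sum fun m hm => ?_
        refine Nat.cast_div_le.trans ?_
        push_cast
        rw [div_eq_mul_inv]
    _ = n * ∑ m ∈ Finset.Ioc Q n, ((m : ℝ) ^ 2)⁻¹ := by rw [Finset.mul_sum]
    _ ≤ n * (Q : ℝ)⁻¹ := by
        refine mul_le_mul_of_nonneg_left ?_ (by positivity)
        refine (sum_Ioc_inv_sq_le_sub (by omega) hle).trans ?_
        simp
    _ = n / Q := by rw [div_eq_mul_inv]


def CC (I : Finset ℕ) (d : ℕ → ℕ) (n : ℕ) : ℕ := ((Finset.Icc 1 n).filter (RR I d)).card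

lemma CC_insert (I : Finset ℕ) (d : ℕ → ℕ) (p : ℕ) (hd : 0 < d p)
    (hc : ∀ q ∈ I, Nat.Coprime (d q) (d p)) (n : ℕ) :
    CC I d n = CC (insert p I) d n + CC I d (n / d p) := by
  unfold CC
  rw [← Finset.card_filter_add_card_filter_not (s := (Finset.Icc 1 n).filter (RR I d))
    (fun r => ¬ d p ∣ r)]
  congr 1
  · congr 1
    ext r
    simp only [Finset.mem_filter, RR, Finset.forall_mem_insert]
    tauto
  · symm
    rw [← Finset.card_image_of_injective _ (fun a b h => Nat.eq_of_mul_eq_mul_left hd h :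
      Function.Injective (fun r => d p * r))]
    congr 1
    ext r
    simp only [Finset.mem_filter, Finset.mem_image, Finset.mem_Icc, not_not]
    constructor
    · rintro ⟨r', ⟨⟨h1, h2⟩, h3⟩, rfl⟩
      rw [Nat.le_div_iff_mul_le hd] at h2
      refine ⟨⟨⟨Nat.mul_pos hd h1, by rw [mul_comm]; exact h2⟩, ?_⟩, dvd_mul_right _ _⟩
      intro q hq hdv
      exact h3 q hq ((hc q hq).dvd_of_dvd_mul_left hdv)
    · rintro ⟨⟨⟨h1, h2⟩, h3⟩, r', rfl⟩
      refine ⟨r', ⟨⟨Nat.pos_of_mul_pos_left h1, ?_⟩, ?_⟩, rfl⟩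
      · rw [Nat.le_div_iff_mul_le hd, mul_comm]; exact h2
      · intro q hq hdv
        exact h3 q hq (hdv.mul_left _)

lemma tendsto_div_nat (s : ℕ) (hs : 0 < s) :
    Tendsto (fun n : ℕ => ((n / s : ℕ) : ℝ) / n) atTop (nhds (1 / (s : ℝ))) := by
  have h := (tendsto_nat_floor_mul_div_atTop (R := ℝ) (a := 1 / (s : ℝ)) (by positivity)).comp
    tendsto_natCast_atTop_atTop
  refine h.congr fun n => ?_
  simp only [Function.comp]
  congr 2
  rw [one_div, inv_mul_eq_div, Nat.floor_div_eq_div]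

lemma tendsto_scale (F : ℕ → ℕ) (l : ℝ) (h : Tendsto (fun n : ℕ => (F n : ℝ) / n) atTop (nhds l))
    (s : ℕ) (hs : 0 < s) :
    Tendsto (fun n : ℕ => (F (n / s) : ℝ) / n) atTop (nhds (l * (1 / (s : ℝ)))) := by
  have h1 := (h.comp (Nat.tendsto_div_const_atTop hs.ne')).mul (tendsto_div_nat s hs)
  refine h1.congr' ?_
  filter_upwards [eventually_ge_atTop s] with n hn
  simp only [Function.comp]
  have : ((n / s : ℕ) : ℝ) ≠ 0 := by
    have := Nat.div_pos hn hs
    positivity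
  field_simp

lemma tendsto_CC (I : Finset ℕ) (d : ℕ → ℕ) (hd : ∀ p ∈ I, 0 < d p)
    (hc : ∀ p ∈ I, ∀ q ∈ I, p ≠ q → Nat.Coprime (d p) (d q)) :
    Tendsto (fun n : ℕ => (CC I d n : ℝ) / n) atTop (nhds (∏ p ∈ I, (1 - 1 / (d p : ℝ)))) := by
  induction I using Finset.induction_on with
  | empty =>
    simp only [Finset.prod_empty]
    refine tendsto_const_nhds.congr' ?_
    filter_upwards [eventually_ge_atTop 1] with n hn
    have : CC ∅ d n = n := by
      unfold CC
      rw [Finset.filter_true_of_mem]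
      · simp
      · intro x _; simp [RR]
    rw [this, div_self]
    positivity
  | insert p I hp ih =>
    rw [Finset.prod_insert hp]
    have ih := ih (fun q hq => hd q (Finset.mem_insert_of_mem hq))
      (fun a ha b hb => hc a (Finset.mem_insert_of_mem ha) b (Finset.mem_insert_of_mem hb))
    have hdp := hd p (Finset.mem_insert_self _ _)
    have h2 := ih.sub (tendsto_scale _ _ ih (d p) hdp)
    have e : (1 - 1 / (d p : ℝ)) * ∏ q ∈ I, (1 - 1 / (d q : ℝ)) =
      (∏ q ∈ I, (1 - 1 / (d q : ℝ))) - (∏ q ∈ I, (1 - 1 / (d q : ℝ))) * (1 / (d p : ℝ)) := by ring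
    rw [e]
    refine h2.congr fun n => ?_
    rw [CC_insert I d p hdp (fun q hq => hc q (Finset.mem_insert_of_mem hq) p
      (Finset.mem_insert_self _ _) (fun h => hp (h ▸ hq))) n]
    push_cast
    ring

/-- step function with jumps `j s` at `s ∈ S` -/
def stp (S : Finset ℕ) (j : ℕ → ℕ) (y : ℕ) : ℕ := ∑ s ∈ S, if s ≤ y then j s else 0

lemma sum_stp (S : Finset ℕ) (j : ℕ → ℕ) (hS : ∀ s ∈ S, 0 < s) (I : Finset ℕ) (d : ℕ → ℕ)
    (n : ℕ) : ∑ r ∈ (Finset.Icc 1 n).filter (RR I d), stp S j (n / r) =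
      ∑ s ∈ S, j s * CC I d (n / s) := by
  unfold stp
  rw [Finset.sum_comm]
  refine Finset.sum_congr rfl fun s hs => ?_
  rw [← Finset.sum_filter, Finset.sum_const, smul_eq_mul, mul_comm]
  congr 1
  unfold CC
  congr 1
  ext r
  simp only [Finset.mem_filter, Finset.mem_Icc]
  have hs0 := hS s hs
  constructor
  · rintro ⟨⟨⟨h1, h2⟩, h3⟩, h4⟩
    rw [Nat.le_div_iff_mul_le (by omega)] at h4
    exact ⟨⟨h1, by rw [Nat.le_div_iff_mul_le hs0, mul_comm]; exact h4⟩, h3⟩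
  · rintro ⟨⟨h1, h2⟩, h3⟩
    rw [Nat.le_div_iff_mul_le hs0] at h2
    refine ⟨⟨⟨h1, ?_⟩, h3⟩, ?_⟩
    · nlinarith
    · rw [Nat.le_div_iff_mul_le (by omega), mul_comm]; exact h2

lemma tendsto_stp (S : Finset ℕ) (j : ℕ → ℕ) (hS : ∀ s ∈ S, 0 < s) (I : Finset ℕ) (d : ℕ → ℕ)
    (hd : ∀ p ∈ I, 0 < d p)
    (hc : ∀ p ∈ I, ∀ q ∈ I, p ≠ q → Nat.Coprime (d p) (d q)) :
    Tendsto (fun n : ℕ => ((∑ r ∈ (Finset.Icc 1 n).filter (RR I d), stp S j (n / r) : ℕ) : ℝ) / n)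
      atTop (nhds ((∑ s ∈ S, (j s : ℝ) / s) * ∏ p ∈ I, (1 - 1 / (d p : ℝ)))) := by
  have h := tendsto_finsetSum S fun s hs =>
    (tendsto_scale _ _ (tendsto_CC I d hd hc) s (hS s hs)).const_mul (j s : ℝ)
  have e : (∑ s ∈ S, (j s : ℝ) / s) * ∏ p ∈ I, (1 - 1 / (d p : ℝ)) =
      ∑ s ∈ S, (j s : ℝ) * ((∏ p ∈ I, (1 - 1 / (d p : ℝ))) * (1 / (s : ℝ))) := by
    rw [Finset.sum_mul]
    exact Finset.sum_congr rfl fun s _ => by ring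
  rw [e]
  refine h.congr fun n => ?_
  rw [sum_stp S j hS I d n]
  push_cast
  rw [Finset.sum_div]
  exact Finset.sum_congr rfl fun s _ => by ring

lemma gN_mono (N : ℕ) : Monotone (gN N) := by
  intro y z hyz
  obtain ⟨A, hA, hy, hg, hc⟩ := gN_attain N y
  rw [← hc]
  exact gN_ge hA (fun a ha => (hy a ha).trans hyz) hg

lemma gN_zero (N : ℕ) (hN : 0 < N) : gN N 0 = 0 := by
  obtain ⟨A, hA, hy, hg, hc⟩ := gN_attain N 0
  rw [← hc, Finset.card_eq_zero, Finset.eq_empty_iff_forall_notMem]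
  intro a ha
  have := Nat.pos_of_mem_divisors (hA ha)
  have := hy a ha
  omega

lemma gN_top (N y : ℕ) (h : N ^ 2 ≤ y) : gN N y = gN N (N ^ 2) := by
  refine le_antisymm ?_ (gN_mono N h)
  obtain ⟨A, hA, hy, hg, hc⟩ := gN_attain N y
  rw [← hc]
  exact gN_ge hA (fun a ha => Nat.divisor_le (hA ha)) hg

lemma mono_stp (g : ℕ → ℕ) (hg : Monotone g) (h0 : g 0 = 0) (M : ℕ) :
    ∀ y ≤ M, g y = stp (Finset.Icc 1 M) (fun s => g s - g (s - 1)) y := by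
  intro y hy
  unfold stp
  rw [← Finset.sum_filter]
  have : (Finset.Icc 1 M).filter (fun s => s ≤ y) = Finset.Icc 1 y := by
    ext s; simp only [Finset.mem_filter, Finset.mem_Icc]; omega
  rw [this]
  clear this hy
  induction y with
  | zero => simp [h0]
  | succ y ih =>
    rw [Finset.sum_Icc_succ_top (by omega), ← ih]
    have := hg (Nat.le_succ y)
    simp only [Nat.succ_eq_add_one] at this
    simp only [Nat.add_sub_cancel]
    omega

lemma gN_stp (N : ℕ) (hN : 0 < N) (y : ℕ) :
    gN N y = stp (Finset.Icc 1 (N ^ 2)) (fun s => gN N s - gN N (s - 1)) y := by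
  rcases Nat.le_total y (N ^ 2) with h | h
  · exact mono_stp _ (gN_mono N) (gN_zero N hN) _ y h
  · rw [gN_top N y h, mono_stp _ (gN_mono N) (gN_zero N hN) (N ^ 2) (N ^ 2) le_rfl]
    unfold stp
    refine Finset.sum_congr rfl fun s hs => ?_
    have := (Finset.mem_Icc.1 hs).2
    rw [if_pos this, if_pos (this.trans h)]

lemma fkd_tendsto : ∃ c : ℝ,
    Tendsto (fun n : ℕ => (fkd 3 3 n : ℝ) / (n : ℝ)) atTop (nhds c) := by
  apply cauchySeq_tendsto_of_complete
  rw [Metric.cauchySeq_iff]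
  intro ε hε
  obtain ⟨Q, hQ⟩ := exists_nat_gt (4 / ε)
  have hQ0 : 0 < Q := by
    have : (0 : ℝ) < Q := lt_trans (by positivity) hQ
    exact_mod_cast this
  have hQε : 1 / (Q : ℝ) < ε / 4 := by
    rw [div_lt_iff₀ (by positivity)] at hQ ⊢
    linarith
  set N := Q.factorial with hNdef
  have hN : 0 < N := Nat.factorial_pos Q
  set I := (Q + 1).primesBelow with hI
  have hIm : ∀ p ∈ I, p.Prime ∧ p ≤ Q := by
    intro p hp
    rw [hI, Nat.mem_primesBelow] at hp
    exact ⟨hp.2, by omega⟩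
  have hlim := tendsto_stp (Finset.Icc 1 (N ^ 2)) (fun s => gN N s - gN N (s - 1))
    (fun s hs => (Finset.mem_Icc.1 hs).1) I id (fun p hp => (hIm p hp).1.pos)
    (fun p hp q hq hpq => (Nat.coprime_primes (hIm p hp).1 (hIm q hq).1).2 hpq)
  simp only [← gN_stp N hN] at hlim
  have hU := upper N hN I id (fun p hp => Or.inl ⟨(hIm p hp).1,
    (hIm p hp).1.dvd_factorial.2 (hIm p hp).2⟩)
  have hL := lower N Q hN I id (by
    intro r hr
    have key : ∀ p : ℕ, p.Prime → p ∣ r → Q < p := by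
      intro p hp hpr
      by_contra hle
      exact hr p (Nat.mem_primesBelow.2 ⟨by omega, hp⟩) hpr
    refine ⟨?_, fun p hp hpp => key p hp ((dvd_mul_right _ _).trans hpp)⟩
    by_contra h
    obtain ⟨p, hp, h1, h2⟩ := Nat.Prime.not_coprime_iff_dvd.1 h
    have := hp.dvd_factorial.1 h2
    have := key p hp h1
    omega)
  have hcau := hlim.cauchySeq
  rw [Metric.cauchySeq_iff] at hcau
  obtain ⟨n0, hn0⟩ := hcau (ε / 4) (by positivity)
  have hcomp : ∀ n : ℕ, 0 < n → |((∑ r ∈ (Finset.Icc 1 n).filter (RR I id), gN N (n / r) : ℕ) : ℝ) / n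
      - (fkd 3 3 n : ℝ) / n| ≤ ε / 4 := by
    intro n hn
    have h1 : (fkd 3 3 n : ℝ) ≤ ((∑ r ∈ (Finset.Icc 1 n).filter (RR I id), gN N (n / r) : ℕ) : ℝ) := by
      exact_mod_cast hU n
    have h2 : ((∑ r ∈ (Finset.Icc 1 n).filter (RR I id), gN N (n / r) : ℕ) : ℝ) ≤
        fkd 3 3 n + n / Q := by
      have : ((∑ r ∈ (Finset.Icc 1 n).filter (RR I id), gN N (n / r) : ℕ) : ℝ) ≤ fkd 3 3 n +
        (((Finset.Icc 1 n).filter (fun a => ∃ m ∈ Finset.Ioc Q n, m ^ 2 ∣ a)).card : ℝ) := by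
        exact_mod_cast hL n
      linarith [bad_count Q n hQ0]
    have hn' : (0 : ℝ) < n := by exact_mod_cast hn
    rw [← sub_div, abs_of_nonneg (div_nonneg (by linarith) hn'.le), div_le_iff₀ hn']
    have : (n : ℝ) / Q = 1 / Q * n := by ring
    nlinarith
  refine ⟨max n0 1, fun m hm n hn => ?_⟩
  have a1 := hcomp m (by omega)
  have a2 := hcomp n (by omega)
  have a3 := hn0 m (by omega) n (by omega)
  rw [Real.dist_eq] at a3 ⊢
  rw [abs_le] at a1 a2
  rw [abs_lt] at a3 ⊢
  constructor <;> linarith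


abbrev VV (d : ℕ) := Fin d → ZMod 3

def Cap {d : ℕ} (A : Finset (VV d)) : Prop :=
  ∀ x ∈ A, ∀ y ∈ A, ∀ z ∈ A, x + y + z = 0 → x = y ∧ y = z

lemma Cap.subset {d : ℕ} {A B : Finset (VV d)} (h : Cap A) (hB : B ⊆ A) : Cap B :=
  fun x hx y hy z hz => h x (hB hx) y (hB hy) z (hB hz)

def sl {d : ℕ} (A : Finset (VV d)) (u : VV d) (t : ZMod 3) : Finset (VV d) :=
  A.filter (fun a => u ⬝ᵥ a = t)

lemma sl_card_le {d M : ℕ} (hM : ∀ B : Finset (VV d), Cap B → B.card ≤ M)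
    {A : Finset (VV (d + 1))} (hA : Cap A) {u : VV (d + 1)} (hu : u ≠ 0) (t : ZMod 3) :
    (sl A u t).card ≤ M := by
  obtain ⟨i, hi⟩ := Function.ne_iff.1 hu
  have hi' : u i ≠ 0 := hi
  have hdot : ∀ a : VV (d + 1), u ⬝ᵥ a = u i * a i + ∑ k, u (i.succAbove k) * a (i.succAbove k) := by
    intro a
    simp only [dotProduct]
    rw [Fin.sum_univ_succAbove _ i]
  have hinj : Set.InjOn (fun a : VV (d + 1) => fun k => a (i.succAbove k)) (sl A u t) := by
    intro a ha b hb he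
    have ha' : u ⬝ᵥ a = t := (Finset.mem_filter.1 ha).2
    have hb' : u ⬝ᵥ b = t := (Finset.mem_filter.1 hb).2
    have he' : ∀ k, a (i.succAbove k) = b (i.succAbove k) := fun k => congrFun he k
    rw [hdot] at ha' hb'
    simp only [he'] at ha'
    have : u i * a i = u i * b i := by
      rw [← hb'] at ha'; exact add_right_cancel ha'
    have hab : a i = b i := mul_left_cancel₀ hi' this
    funext k
    rcases Fin.eq_self_or_eq_succAbove i k with rfl | ⟨k, rfl⟩
    · exact hab
    · exact he' k
  rw [← Finset.card_image_of_injOn hinj]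
  apply hM
  intro x hx y hy z hz he
  obtain ⟨a, ha, rfl⟩ := Finset.mem_image.1 hx
  obtain ⟨b, hb, rfl⟩ := Finset.mem_image.1 hy
  obtain ⟨c, hc, rfl⟩ := Finset.mem_image.1 hz
  have ha' := Finset.mem_filter.1 ha
  have hb' := Finset.mem_filter.1 hb
  have hc' := Finset.mem_filter.1 hc
  have hk : ∀ k, (a + b + c) (i.succAbove k) = 0 := fun k => congrFun he k
  have hs : u ⬝ᵥ (a + b + c) = 0 := by
    rw [dotProduct_add, dotProduct_add, ha'.2, hb'.2, hc'.2]
    have h3 : ∀ t : ZMod 3, t + t + t = 0 := by decide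
    exact h3 t
  rw [hdot] at hs
  simp only [hk, mul_zero, Finset.sum_const_zero, add_zero] at hs
  have h0 : a + b + c = 0 := by
    funext k
    rcases Fin.eq_self_or_eq_succAbove i k with rfl | ⟨k, rfl⟩
    · exact (mul_eq_zero.1 hs).resolve_left hi'
    · exact hk k
  obtain ⟨h1, h2⟩ := hA a ha'.1 b hb'.1 c hc'.1 h0
  rw [h1, h2]; exact ⟨rfl, rfl⟩

lemma ker_card {d m : ℕ} (w : Fin m → VV d) (hw : LinearIndependent (ZMod 3) w) (hm : m ≤ d) :
    (Finset.univ.filter (fun u : VV d => ∀ i, u ⬝ᵥ w i = 0)).card = 3 ^ (d - m) := by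
  classical
  set f := Matrix.mulVecLin (Matrix.of w) with hf
  have hr : Module.finrank (ZMod 3) (LinearMap.range f) = m := by
    have := LinearIndependent.rank_matrix (M := Matrix.of w) hw
    rw [Matrix.rank] at this
    simpa using this
  have hk : Module.finrank (ZMod 3) (LinearMap.ker f) = d - m := by
    have := LinearMap.finrank_range_add_finrank_ker f
    rw [hr] at this
    simp at this
    omega
  have hc := Module.card_eq_pow_finrank (K := ZMod 3) (V := LinearMap.ker f)
  rw [hk, ZMod.card] at hc
  rw [← hc, Fintype.card_subtype]
  congr 1
  ext u
  simp only [Finset.mem_filter, Finset.mem_univ, true_and, LinearMap.mem_ker, hf,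
    Matrix.mulVecLin_apply, funext_iff, Matrix.mulVec, Pi.zero_apply, Matrix.of_apply]
  constructor
  · intro h i; rw [dotProduct_comm]; exact h i
  · intro h i; rw [dotProduct_comm]; exact h i

lemma ker1 {d : ℕ} {w : VV (d + 1)} (hw : w ≠ 0) :
    (Finset.univ.filter (fun u : VV (d + 1) => u ⬝ᵥ w = 0)).card = 3 ^ d := by
  have := ker_card (d := d + 1) ![w] (by
    rw [linearIndependent_unique_iff]; simpa using hw) (by omega)
  simpa using this

lemma ker2 {d : ℕ} {w w' : VV (d + 2)} (h : LinearIndependent (ZMod 3) ![w, w']) :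
    (Finset.univ.filter (fun u : VV (d + 2) => u ⬝ᵥ w = 0 ∧ u ⬝ᵥ w' = 0)).card = 3 ^ d := by
  have := ker_card (d := d + 2) ![w, w'] h (by omega)
  simpa [Fin.forall_fin_two] using this

lemma cap_indep {d : ℕ} {A : Finset (VV d)} (hA : Cap A) {a b c : VV d} (ha : a ∈ A) (hb : b ∈ A)
    (hc : c ∈ A) (hab : a ≠ b) (hac : a ≠ c) (hbc : b ≠ c) :
    LinearIndependent (ZMod 3) ![a - b, a - c] := by
  rw [LinearIndependent.pair_iff' (sub_ne_zero.2 hab)]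
  intro s hs
  have h3 : ∀ x : ZMod 3, x + x + x = 0 := by decide
  have hs3 : s = 0 ∨ s = 1 ∨ s = 2 := by
    have h4 : ∀ s : ZMod 3, s = 0 ∨ s = 1 ∨ s = 2 := by decide
    exact h4 s
  rcases hs3 with rfl | rfl | rfl
  · rw [zero_smul] at hs
    exact hac (sub_eq_zero.1 hs.symm)
  · rw [one_smul] at hs
    exact hbc (sub_right_injective hs)
  · have : a + b + c = 0 := by
      funext k
      have h1 := congrFun hs k
      simp only [Pi.smul_apply, Pi.sub_apply, smul_eq_mul] at h1
      simp only [Pi.add_apply, Pi.zero_apply]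
      have h5 : ∀ x y z : ZMod 3, 2 * (x - y) = x - z → x + y + z = 0 := by decide
      exact h5 _ _ _ h1
    exact hab (hA a ha b hb c hc this).1

lemma sl_sq {d : ℕ} (A : Finset (VV d)) (u : VV d) :
    ∑ t, (sl A u t).card ^ 2 = ∑ a ∈ A, ∑ b ∈ A, if u ⬝ᵥ (a - b) = 0 then 1 else 0 := by
  have : ∀ a b : VV d, (if u ⬝ᵥ (a - b) = 0 then 1 else 0) =
      ∑ t, (if u ⬝ᵥ a = t then 1 else 0) * (if u ⬝ᵥ b = t then 1 else 0) := by
    intro a b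
    rw [dotProduct_sub]
    generalize u ⬝ᵥ a = x
    generalize u ⬝ᵥ b = y
    revert x y; decide
  simp only [this]
  have e : ∀ t, (sl A u t).card ^ 2 = ∑ a ∈ A, ∑ b ∈ A,
      (if u ⬝ᵥ a = t then 1 else 0) * (if u ⬝ᵥ b = t then 1 else 0) := by
    intro t
    rw [sl, Finset.card_filter, pow_two, Finset.sum_mul_sum]
  simp only [e]
  rw [Finset.sum_comm]
  exact Finset.sum_congr rfl fun a _ => Finset.sum_comm

lemma sl_cube {d : ℕ} (A : Finset (VV d)) (u : VV d) :
    ∑ t, (sl A u t).card ^ 3 = ∑ a ∈ A, ∑ b ∈ A, ∑ c ∈ A,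
      if u ⬝ᵥ (a - b) = 0 ∧ u ⬝ᵥ (a - c) = 0 then 1 else 0 := by
  have : ∀ a b c : VV d, (if u ⬝ᵥ (a - b) = 0 ∧ u ⬝ᵥ (a - c) = 0 then 1 else 0) =
      ∑ t, (if u ⬝ᵥ a = t then 1 else 0) * (if u ⬝ᵥ b = t then 1 else 0) *
        (if u ⬝ᵥ c = t then 1 else 0) := by
    intro a b c
    rw [dotProduct_sub, dotProduct_sub]
    generalize u ⬝ᵥ a = x
    generalize u ⬝ᵥ b = y
    generalize u ⬝ᵥ c = z
    revert x y z; decide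
  simp only [this]
  have e : ∀ t, (sl A u t).card ^ 3 = ∑ a ∈ A, ∑ b ∈ A, ∑ c ∈ A,
      (if u ⬝ᵥ a = t then 1 else 0) * (if u ⬝ᵥ b = t then 1 else 0) *
        (if u ⬝ᵥ c = t then 1 else 0) := by
    intro t
    rw [sl, Finset.card_filter, pow_succ, pow_two, Finset.sum_mul_sum, Finset.sum_mul]
    refine Finset.sum_congr rfl fun a _ => ?_
    rw [Finset.sum_mul]
    refine Finset.sum_congr rfl fun b _ => ?_
    rw [Finset.mul_sum]
  simp only [e]
  rw [Finset.sum_comm]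
  refine Finset.sum_congr rfl fun a _ => ?_
  rw [Finset.sum_comm]
  refine Finset.sum_congr rfl fun b _ => ?_
  rw [Finset.sum_comm]

lemma moment2 {d : ℕ} (A : Finset (VV (d + 1))) :
    ∑ u, ∑ t, (sl A u t).card ^ 2 = 3 ^ d * (A.card ^ 2 + 2 * A.card) := by
  simp only [sl_sq]
  rw [Finset.sum_comm]
  have : ∀ a ∈ A, ∑ u : VV (d + 1), ∑ b ∈ A, (if u ⬝ᵥ (a - b) = 0 then 1 else 0) =
      3 ^ d * (A.card + 2) := by
    intro a ha
    rw [Finset.sum_comm]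
    have e : ∀ b ∈ A, ∑ u : VV (d + 1), (if u ⬝ᵥ (a - b) = 0 then 1 else 0) =
        3 ^ d * (1 + 2 * if a = b then 1 else 0) := by
      intro b _
      by_cases hab : a = b
      · subst hab
        simp [ZMod.card, pow_succ]
      · rw [← Finset.card_filter, ker1 (sub_ne_zero.2 hab)]
        simp [hab]
    rw [Finset.sum_congr rfl e, ← Finset.mul_sum, Finset.sum_add_distrib, ← Finset.mul_sum]
    simp [ha]
  rw [Finset.sum_congr rfl this, Finset.sum_const, smul_eq_mul]
  ring

lemma moment3 {d : ℕ} (A : Finset (VV (d + 2))) (hA : Cap A) :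
    ∑ u, ∑ t, (sl A u t).card ^ 3 = 3 ^ d * (A.card ^ 3 + 6 * A.card ^ 2 + 2 * A.card) := by
  simp only [sl_cube]
  have e : ∀ a ∈ A, ∀ b ∈ A, ∀ c ∈ A,
      ∑ u : VV (d + 2), (if u ⬝ᵥ (a - b) = 0 ∧ u ⬝ᵥ (a - c) = 0 then 1 else 0) =
        3 ^ d * (1 + 2 * (if a = b then 1 else 0) + 2 * (if a = c then 1 else 0) +
          2 * (if b = c then 1 else 0) + 2 * (if a = b then (if a = c then 1 else 0) else 0)) := by
    intro a ha b hb c hc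
    by_cases hab : a = b
    · subst hab
      by_cases hac : a = c
      · subst hac
        simp [ZMod.card, pow_succ]
        ring
      · simp only [sub_self, dotProduct_zero, true_and]
        rw [← Finset.card_filter, ker1 (sub_ne_zero.2 hac)]
        simp [hac]
        ring
    · by_cases hac : a = c
      · subst hac
        simp only [sub_self, dotProduct_zero, and_true]
        rw [← Finset.card_filter, ker1 (sub_ne_zero.2 hab)]
        simp [hab, Ne.symm hab]
        ring
      · by_cases hbc : b = c
        · subst hbc
          simp only [and_self]
          rw [← Finset.card_filter, ker1 (sub_ne_zero.2 hab)]
          simp [hab]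
          ring
        · rw [← Finset.card_filter, ker2 (cap_indep hA ha hb hc hab hac hbc)]
          simp [hab, hac, hbc]
  rw [Finset.sum_comm]
  have e1 : ∀ a ∈ A, ∑ u : VV (d + 2), ∑ b ∈ A, ∑ c ∈ A,
      (if u ⬝ᵥ (a - b) = 0 ∧ u ⬝ᵥ (a - c) = 0 then 1 else 0) =
      3 ^ d * (A.card ^ 2 + 6 * A.card + 2) := by
    intro a ha
    rw [Finset.sum_comm]
    have e2 : ∀ b ∈ A, ∑ u : VV (d + 2), ∑ c ∈ A,
      (if u ⬝ᵥ (a - b) = 0 ∧ u ⬝ᵥ (a - c) = 0 then 1 else 0) =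
      3 ^ d * (A.card + 4 + (2 * A.card + 2) * (if a = b then 1 else 0)) := by
      intro b hb
      rw [Finset.sum_comm, Finset.sum_congr rfl (e a ha b hb), ← Finset.mul_sum]
      simp only [Finset.sum_add_distrib, ← Finset.mul_sum]
      congr 1
      by_cases hab : a = b
      · subst hab
        simp [ha]
        ring
      · simp [ha, hb, hab]
    rw [Finset.sum_congr rfl e2, ← Finset.mul_sum, Finset.sum_add_distrib, ← Finset.mul_sum]
    simp [ha]
    ring
  rw [Finset.sum_congr rfl e1, Finset.sum_const, smul_eq_mul]
  ring

lemma sl_sum {d : ℕ} (A : Finset (VV d)) (u : VV d) :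
    (sl A u 0).card + (sl A u 1).card + (sl A u 2).card = A.card := by
  have := Finset.card_eq_sum_card_fiberwise (s := A) (t := (Finset.univ : Finset (ZMod 3)))
    (f := fun a => u ⬝ᵥ a) (by intro x _; simp)
  rw [this]
  exact (Fin.sum_univ_three (fun t : Fin 3 => (sl A u t).card)).symm

lemma sum3 (f : ZMod 3 → ℕ) : ∑ t, f t = f 0 + f 1 + f 2 := Fin.sum_univ_three f

lemma sl_zero {d : ℕ} (A : Finset (VV d)) (t : ZMod 3) :
    (sl A 0 t).card = if t = 0 then A.card else 0 := by
  unfold sl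
  by_cases h : t = 0
  · subst h; simp
  · simp [h, Ne.symm h]

lemma cap1 (A : Finset (VV 1)) (hA : Cap A) : A.card ≤ 2 := by
  by_contra h
  have h1 : A.card ≤ 3 := by
    have := Finset.card_le_univ A
    simpa [ZMod.card] using this
  have : A = Finset.univ := by
    rw [← Finset.card_eq_iff_eq_univ]
    simp [ZMod.card]; omega
  subst this
  have := hA (fun _ => 0) (Finset.mem_univ _) (fun _ => 1) (Finset.mem_univ _) (fun _ => 2)
    (Finset.mem_univ _) (by decide)
  exact absurd this.1 (by decide)

lemma cap_bound2 {d M k B : ℕ} (hM : ∀ A : Finset (VV d), Cap A → A.card ≤ M)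
    (hB : ∀ x y z : ℕ, x ≤ M → y ≤ M → z ≤ M → x + y + z = k + 1 → x ^ 2 + y ^ 2 + z ^ 2 ≤ B)
    (hlt : (k + 1) ^ 2 + (3 ^ (d + 1) - 1) * B < 3 ^ d * ((k + 1) ^ 2 + 2 * (k + 1)))
    (A : Finset (VV (d + 1))) (hA : Cap A) : A.card ≤ k := by
  by_contra h
  obtain ⟨A', hsub, hc⟩ := Finset.exists_subset_card_eq (show k + 1 ≤ A.card by omega)
  have hA' := hA.subset hsub
  have hm := moment2 A'
  rw [hc, ← Finset.add_sum_erase _ _ (Finset.mem_univ (0 : VV (d + 1)))] at hm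
  have h0 : ∑ t, (sl A' 0 t).card ^ 2 = (k + 1) ^ 2 := by
    simp [sl_zero, hc, ite_pow]
  have h1 : ∑ u ∈ Finset.univ.erase (0 : VV (d + 1)), ∑ t, (sl A' u t).card ^ 2 ≤
      (3 ^ (d + 1) - 1) * B := by
    have := Finset.sum_le_card_nsmul (Finset.univ.erase (0 : VV (d + 1)))
      (fun u => ∑ t, (sl A' u t).card ^ 2) B (by
        intro u hu
        have hu0 := Finset.ne_of_mem_erase hu
        rw [sum3]
        refine hB _ _ _ (sl_card_le hM hA' hu0 0) (sl_card_le hM hA' hu0 1)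
          (sl_card_le hM hA' hu0 2) ?_
        rw [sl_sum, hc])
    rw [Finset.card_erase_of_mem (Finset.mem_univ _), smul_eq_mul] at this
    simpa [ZMod.card] using this
  omega

lemma cap2 (A : Finset (VV 2)) (hA : Cap A) : A.card ≤ 4 := by
  refine cap_bound2 (d := 1) (M := 2) (k := 4) (B := 9) cap1 ?_ (by norm_num) A hA
  intro x y z hx hy hz h
  interval_cases x <;> interval_cases y <;> interval_cases z <;> omega

lemma cap3 (A : Finset (VV 3)) (hA : Cap A) : A.card ≤ 9 := by
  refine cap_bound2 (d := 2) (M := 4) (k := 9) (B := 36) cap2 ?_ (by norm_num) A hA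
  intro x y z hx hy hz h
  interval_cases x <;> interval_cases y <;> interval_cases z <;> omega

lemma type21 : ∀ x < (10 : ℕ), ∀ y < (10 : ℕ), ∀ z < (10 : ℕ), x + y + z = 21 →
    19 * (x ^ 2 + y ^ 2 + z ^ 2) ≤ x ^ 3 + y ^ 3 + z ^ 3 + 1764 ∧
    (19 * (x ^ 2 + y ^ 2 + z ^ 2) = x ^ 3 + y ^ 3 + z ^ 3 + 1764 →
      x ^ 2 + y ^ 2 + z ^ 2 = 147 ∨ x ^ 2 + y ^ 2 + z ^ 2 = 171) := by
  intro x hx y hy z hz h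
  obtain ⟨z, rfl⟩ : ∃ w, z = w := ⟨z, rfl⟩
  interval_cases x <;> interval_cases y <;>
    first
    | omega
    | (interval_cases z <;> first | omega | norm_num)

lemma sl_neg {d : ℕ} (A : Finset (VV d)) (u : VV d) (t : ZMod 3) : sl A (-u) t = sl A u (-t) := by
  unfold sl
  ext a
  simp only [Finset.mem_filter, neg_dotProduct]
  constructor
  · rintro ⟨h1, h2⟩; exact ⟨h1, by rw [← h2, neg_neg]⟩
  · rintro ⟨h1, h2⟩; exact ⟨h1, by rw [h2, neg_neg]⟩

lemma cap4 (A : Finset (VV 4)) (hA : Cap A) : A.card ≤ 20 := by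
  by_contra h
  obtain ⟨A', hsub, hc⟩ := Finset.exists_subset_card_eq (show 21 ≤ A.card by omega)
  have hA' := hA.subset hsub
  set q : VV 4 → ℕ := fun u => ∑ t, (sl A' u t).card ^ 2 with hq
  set r : VV 4 → ℕ := fun u => ∑ t, (sl A' u t).card ^ 3 with hr
  set U := Finset.univ.erase (0 : VV 4) with hU
  have hUc : U.card = 80 := by
    rw [hU, Finset.card_erase_of_mem (Finset.mem_univ _)]
    simp [ZMod.card]
  have h2 : ∑ u ∈ U, q u = 12600 := by
    have hm := moment2 A'
    rw [hc, ← Finset.add_sum_erase _ _ (Finset.mem_univ (0 : VV 4))] at hm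
    have h0 : ∑ t, (sl A' 0 t).card ^ 2 = 21 ^ 2 := by
      simp [sl_zero, hc, ite_pow]
    rw [h0] at hm
    have : 21 ^ 2 + ∑ u ∈ U, q u = 3 ^ 3 * (21 ^ 2 + 2 * 21) := hm
    omega
  have h3 : ∑ u ∈ U, r u = 98280 := by
    have hm := moment3 A' hA'
    rw [hc, ← Finset.add_sum_erase _ _ (Finset.mem_univ (0 : VV 4))] at hm
    have h0 : ∑ t, (sl A' 0 t).card ^ 3 = 21 ^ 3 := by
      simp [sl_zero, hc, ite_pow]
    rw [h0] at hm
    have : 21 ^ 3 + ∑ u ∈ U, r u = 3 ^ 2 * (21 ^ 3 + 6 * 21 ^ 2 + 2 * 21) := hm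
    omega
  have htype : ∀ u ∈ U, 19 * q u ≤ r u + 1764 ∧ (19 * q u = r u + 1764 → q u = 147 ∨ q u = 171) := by
    intro u hu
    have hu0 := Finset.ne_of_mem_erase hu
    simp only [hq, hr, sum3]
    refine type21 _ (Nat.lt_succ_of_le (sl_card_le cap3 hA' hu0 0)) _
      (Nat.lt_succ_of_le (sl_card_le cap3 hA' hu0 1)) _
      (Nat.lt_succ_of_le (sl_card_le cap3 hA' hu0 2)) ?_
    rw [sl_sum, hc]
  have hsum : ∑ u ∈ U, 19 * q u = ∑ u ∈ U, (r u + 1764) := by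
    rw [← Finset.mul_sum, h2, Finset.sum_add_distrib, h3, Finset.sum_const, hUc]
    norm_num
  have heq := (Finset.sum_eq_sum_iff_of_le (fun u hu => (htype u hu).1)).1 hsum
  have hval : ∀ u ∈ U, q u = 147 ∨ q u = 171 := fun u hu => (htype u hu).2 (heq u hu)
  have hcount : (U.filter (fun u => q u = 171)).card = 35 := by
    have e : ∀ u ∈ U, q u = 147 + 24 * (if q u = 171 then 1 else 0) := by
      intro u hu
      rcases hval u hu with h | h <;> rw [h] <;> norm_num
    rw [Finset.sum_congr rfl e, Finset.sum_add_distrib, ← Finset.mul_sum, ← Finset.card_filter,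
      Finset.sum_const, hUc] at h2
    simp only [smul_eq_mul] at h2
    omega
  have hqneg : ∀ u, q (-u) = q u := by
    intro u
    simp only [hq, sl_neg]
    exact Fintype.sum_equiv (Equiv.neg _) _ _ fun t => rfl
  have hpar : ∑ u ∈ U.filter (fun u => q u = 171), (1 : ZMod 2) = 0 := by
    refine Finset.sum_involution (fun u _ => -u) ?_ ?_ ?_ ?_
    · intro u _; decide
    · intro u hu _ he
      have hu0 := Finset.ne_of_mem_erase (Finset.mem_filter.1 hu).1
      apply hu0
      funext k
      have := congrFun he k
      simp only [Pi.neg_apply] at this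
      simp only [Pi.zero_apply]
      generalize u k = x at *
      revert x; decide
    · intro u hu
      rw [Finset.mem_filter] at hu ⊢
      refine ⟨Finset.mem_erase.2 ⟨neg_ne_zero.2 (Finset.ne_of_mem_erase hu.1), Finset.mem_univ _⟩, ?_⟩
      rw [hqneg, hu.2]
    · intro u _; exact neg_neg u
  rw [Finset.sum_const, hcount] at hpar
  exact absurd hpar (by decide)


def ee (p a : ℕ) : ℕ := if p ^ 2 ∣ a then 2 else if p ∣ a then 1 else 0

def cd (a : ℕ) : ℕ := ee 2 a + 7 * ee 3 a + 49 * ee 5 a + 343 * ee 7 a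

lemma ee_le (p a : ℕ) : ee p a ≤ 2 := by
  unfold ee; split_ifs <;> omega

lemma ee_fact {p a : ℕ} (hp : p.Prime) (ha : a ≠ 0) (h3 : ¬ p ^ 3 ∣ a) :
    a.factorization p = ee p a := by
  have h0 := hp.pow_dvd_iff_le_factorization (k := 3) ha
  have h2 := hp.pow_dvd_iff_le_factorization (k := 2) ha
  have h1 := hp.pow_dvd_iff_le_factorization (k := 1) ha
  rw [pow_one] at h1
  unfold ee
  split_ifs with c1 c2
  · have := h2.1 c1
    have : ¬ 3 ≤ a.factorization p := fun h => h3 (h0.2 h)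
    omega
  · have := h1.1 c2
    have : ¬ 2 ≤ a.factorization p := fun h => c1 (h2.2 h)
    omega
  · have : ¬ 1 ≤ a.factorization p := fun h => c2 (h1.2 h)
    omega

lemma rep {a : ℕ} (h : a ∣ 44100) : a = 2 ^ ee 2 a * 3 ^ ee 3 a * 5 ^ ee 5 a * 7 ^ ee 7 a := by
  have h' : a ∣ (2 ^ 2 * 3 ^ 2) * (5 ^ 2 * 7 ^ 2) := by norm_num; exact h
  obtain ⟨u, v, hu, hv, rfl⟩ := (Nat.dvd_mul).1 h'
  obtain ⟨b, c, hb, hc, rfl⟩ := (Nat.dvd_mul).1 hu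
  obtain ⟨d, e, hd, he, rfl⟩ := (Nat.dvd_mul).1 hv
  obtain ⟨i, hi, rfl⟩ := (Nat.dvd_prime_pow (by norm_num)).1 hb
  obtain ⟨j, hj, rfl⟩ := (Nat.dvd_prime_pow (by norm_num)).1 hc
  obtain ⟨k, hk, rfl⟩ := (Nat.dvd_prime_pow (by norm_num)).1 hd
  obtain ⟨l, hl, rfl⟩ := (Nat.dvd_prime_pow (by norm_num)).1 he
  have key : ∀ i < 3, ∀ j < 3, ∀ k < 3, ∀ l < 3, 2 ^ i * 3 ^ j * (5 ^ k * 7 ^ l) =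
      2 ^ ee 2 (2 ^ i * 3 ^ j * (5 ^ k * 7 ^ l)) * 3 ^ ee 3 (2 ^ i * 3 ^ j * (5 ^ k * 7 ^ l)) *
      5 ^ ee 5 (2 ^ i * 3 ^ j * (5 ^ k * 7 ^ l)) * 7 ^ ee 7 (2 ^ i * 3 ^ j * (5 ^ k * 7 ^ l)) := by
    decide +kernel
  exact key i (by omega) j (by omega) k (by omega) l (by omega)

def pr4 : List ℕ := [2, 3, 5, 7]

lemma cube_of_ee {a b c : ℕ} (ha : a ∣ 44100) (hb : b ∣ 44100) (hc : c ∣ 44100)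
    (h : ∀ p ∈ pr4, 3 ∣ ee p a + ee p b + ee p c) : ∃ x, 0 < x ∧ a * b * c = x ^ 3 := by
  obtain ⟨i, hi⟩ := h 2 (by simp [pr4])
  obtain ⟨j, hj⟩ := h 3 (by simp [pr4])
  obtain ⟨k, hk⟩ := h 5 (by simp [pr4])
  obtain ⟨l, hl⟩ := h 7 (by simp [pr4])
  refine ⟨2 ^ i * 3 ^ j * 5 ^ k * 7 ^ l, by positivity, ?_⟩
  have e1 : a * b * c = 2 ^ (ee 2 a + ee 2 b + ee 2 c) * 3 ^ (ee 3 a + ee 3 b + ee 3 c) *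
      5 ^ (ee 5 a + ee 5 b + ee 5 c) * 7 ^ (ee 7 a + ee 7 b + ee 7 c) := by
    conv_lhs => rw [rep ha, rep hb, rep hc]
    ring
  rw [e1, hi, hj, hk, hl]
  ring

lemma ee_of_cube {a b c x : ℕ} (ha : a ∣ 44100) (hb : b ∣ 44100) (hc : c ∣ 44100)
    (h : a * b * c = x ^ 3) : ∀ p ∈ pr4, 3 ∣ ee p a + ee p b + ee p c := by
  intro p hp
  have hp' : p.Prime ∧ ¬ p ^ 3 ∣ 44100 := by
    simp only [pr4, List.mem_cons, List.not_mem_nil, or_false] at hp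
    rcases hp with rfl | rfl | rfl | rfl <;> norm_num
  have a0 : a ≠ 0 := by rintro rfl; norm_num at ha
  have b0 : b ≠ 0 := by rintro rfl; norm_num at hb
  have c0 : c ≠ 0 := by rintro rfl; norm_num at hc
  rw [← ee_fact hp'.1 a0 (fun h => hp'.2 (h.trans ha)),
    ← ee_fact hp'.1 b0 (fun h => hp'.2 (h.trans hb)),
    ← ee_fact hp'.1 c0 (fun h => hp'.2 (h.trans hc))]
  have h1 := congrArg (fun n => n.factorization p) h
  simp only [Nat.factorization_pow, Nat.factorization_mul (mul_ne_zero a0 b0) c0,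
    Nat.factorization_mul a0 b0, Finsupp.add_apply, Finsupp.smul_apply, smul_eq_mul] at h1
  exact ⟨_, h1⟩

def col (s : ℕ) : Bool :=
  Nat.beq (s % 7 % 3) 0 && (Nat.beq (s / 7 % 7 % 3) 0 &&
    (Nat.beq (s / 49 % 7 % 3) 0 && Nat.beq (s / 343 % 3) 0))

lemma digits (i j k l : ℕ) (hi : i < 7) (hj : j < 7) (hk : k < 7) :
    ((i + 7 * j + 49 * k + 343 * l) % 7 % 3 = 0 ∧ (i + 7 * j + 49 * k + 343 * l) / 7 % 7 % 3 = 0 ∧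
      (i + 7 * j + 49 * k + 343 * l) / 49 % 7 % 3 = 0 ∧ (i + 7 * j + 49 * k + 343 * l) / 343 % 3 = 0)
      ↔ 3 ∣ i ∧ 3 ∣ j ∧ 3 ∣ k ∧ 3 ∣ l := by
  have e1 : (i + 7 * j + 49 * k + 343 * l) % 7 = i := by omega
  have e2 : (i + 7 * j + 49 * k + 343 * l) / 7 % 7 = j := by omega
  have e3 : (i + 7 * j + 49 * k + 343 * l) / 49 % 7 = k := by omega
  have e4 : (i + 7 * j + 49 * k + 343 * l) / 343 = l := by omega
  rw [e1, e2, e3, e4]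
  simp only [Nat.dvd_iff_mod_eq_zero]

lemma col_iff (a b c : ℕ) : col (cd a + cd b + cd c) = true ↔
    ∀ p ∈ pr4, 3 ∣ ee p a + ee p b + ee p c := by
  have f := fun p q => ee_le p q
  have := f 2 a
  have := f 2 b
  have := f 2 c
  have := f 3 a
  have := f 3 b
  have := f 3 c
  have := f 5 a
  have := f 5 b
  have := f 5 c
  have := f 7 a
  have := f 7 b
  have := f 7 c
  have e1 : cd a + cd b + cd c = (ee 2 a + ee 2 b + ee 2 c) + 7 * (ee 3 a + ee 3 b + ee 3 c) +
    49 * (ee 5 a + ee 5 b + ee 5 c) + 343 * (ee 7 a + ee 7 b + ee 7 c) := by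
    unfold cd; ring
  rw [e1]
  unfold col
  simp only [pr4, List.mem_cons, List.not_mem_nil, or_false, forall_eq_or_imp, forall_eq,
    Bool.and_eq_true, Nat.beq_eq]
  have h2 : ee 2 a + ee 2 b + ee 2 c < 7 := by omega
  have h3 : ee 3 a + ee 3 b + ee 3 c < 7 := by omega
  have h5 : ee 5 a + ee 5 b + ee 5 c < 7 := by omega
  exact digits _ _ _ _ h2 h3 h5

def srch : ℕ → List ℕ → List ℕ → ℕ → Bool
  | 0, _, _, _ => false
  | _ + 1, _, _, 0 => false
  | _ + 1, _, [], _ + 1 => true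
  | f + 1, ch, x :: cs, n + 1 =>
    bif Nat.blt (x :: cs).length (n + 1) then true else
      srch f ch cs (n + 1) && srch f (x :: ch)
        (cs.filter fun z => ch.all fun q => !(col (q + x + z)) || Nat.beq q x) n

lemma srch_sound (A : Finset ℕ)
    (hA : ∀ a ∈ A, ∀ b ∈ A, ∀ c ∈ A, col (a + b + c) = true → a = b ∧ b = c) :
    ∀ (f : ℕ) (ch cs : List ℕ) (n : ℕ), (∀ q ∈ ch, q ∈ A) → srch f ch cs n = true →
      (cs.filter (fun a => decide (a ∈ A))).length < n := by
  intro f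
  induction f with
  | zero => intro ch cs n _ h; simp [srch] at h
  | succ f ih =>
    intro ch cs n hch h
    match n, cs, h with
    | 0, _, h => simp [srch] at h
    | n + 1, [], _ => simp
    | n + 1, x :: cs, h =>
      rw [srch, cond_eq_ite] at h
      split_ifs at h with hlt
      · have h1 : (x :: cs).length < n + 1 := by simpa [Nat.blt] using hlt
        exact lt_of_le_of_lt (List.length_filter_le _ _) h1
      · rw [Bool.and_eq_true] at h
        by_cases hx : x ∈ A
        · have h2 := ih (x :: ch) _ n (by
            intro q hq
            rcases List.mem_cons.1 hq with rfl | hq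
            · exact hx
            · exact hch q hq) h.2
          rw [List.filter_filter] at h2
          rw [List.filter_cons_of_pos (by simpa using hx), List.length_cons]
          have h3 : cs.filter (fun a => decide (a ∈ A)) = cs.filter (fun a => decide (a ∈ A) &&
              ch.all fun q => !(col (q + x + a)) || Nat.beq q x) := by
            apply List.filter_congr
            intro z _
            by_cases hz : z ∈ A
            · simp only [hz, decide_true, Bool.true_and]
              symm
              rw [List.all_eq_true]
              intro q hq
              by_cases hc : col (q + x + z) = true
              · have := (hA q (hch q hq) x hx z hz hc).1
                simp [this]
              · simp [hc]
            · simp [hz]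
          rw [h3]
          omega
        · rw [List.filter_cons_of_neg (by simpa using hx)]
          exact ih ch cs (n + 1) hch h.1

lemma good_col {A : Finset ℕ} (hA : ∀ a ∈ A, a ∣ 44100) (hg : Good A) :
    ∀ a ∈ A, ∀ b ∈ A, ∀ c ∈ A, col (cd a + cd b + cd c) = true → a = b ∧ b = c := by
  intro a ha b hb c hc h
  obtain ⟨x, hx, h⟩ := cube_of_ee (hA a ha) (hA b hb) (hA c hc) ((col_iff a b c).1 h)
  exact hg a ha b hb c hc x hx h

lemma srch_card {A : Finset ℕ} (hA : ∀ a ∈ A, a ∣ 44100) (hg : Good A) (F : List ℕ) (m : ℕ)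
    (h : srch 200 [] (F.map cd) (m + 1) = true) : (A.filter (· ∈ F)).card ≤ m := by
  have h1 := srch_sound (A.image cd) (by
    intro a ha b hb c hc hcol
    obtain ⟨a, ha', rfl⟩ := Finset.mem_image.1 ha
    obtain ⟨b, hb', rfl⟩ := Finset.mem_image.1 hb
    obtain ⟨c, hc', rfl⟩ := Finset.mem_image.1 hc
    obtain ⟨h1, h2⟩ := good_col hA hg a ha' b hb' c hc' hcol
    rw [h1, h2]; exact ⟨rfl, rfl⟩) 200 [] (F.map cd) (m + 1) (by simp) h
  have h2 : (F.filter (fun a => decide (a ∈ A))).length ≤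
      ((F.map cd).filter (fun a => decide (a ∈ A.image cd))).length := by
    rw [List.filter_map, List.length_map]
    rw [← List.countP_eq_length_filter, ← List.countP_eq_length_filter]
    apply List.countP_mono_left
    intro x _ hx
    simp only [Function.comp, decide_eq_true_eq] at hx ⊢
    exact Finset.mem_image_of_mem _ hx
  have h3 : A.filter (· ∈ F) ⊆ (F.filter (fun a => decide (a ∈ A))).toFinset := by
    intro a ha
    rw [Finset.mem_filter] at ha
    simp [ha.1, ha.2]
  have h4 := (Finset.card_le_card h3).trans (List.toFinset_card_le _)
  omega

def vv (a : ℕ) : VV 4 := ![(ee 2 a : ZMod 3), (ee 3 a : ZMod 3), (ee 5 a : ZMod 3), (ee 7 a : ZMod 3)]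

lemma ee_cast {p a b : ℕ} (h : (ee p a : ZMod 3) = ee p b) : ee p a = ee p b := by
  rw [ZMod.natCast_eq_natCast_iff'] at h
  have := ee_le p a
  have := ee_le p b
  omega

lemma vv_inj {A : Finset ℕ} (hA : ∀ a ∈ A, a ∣ 44100) : Set.InjOn vv A := by
  intro a ha b hb h
  have h0 := ee_cast (congrFun h 0)
  have h1 := ee_cast (congrFun h 1)
  have h2 := ee_cast (congrFun h 2)
  have h3 := ee_cast (congrFun h 3)
  rw [rep (hA a ha), rep (hA b hb), h0, h1, h2, h3]

lemma vv_cap {A : Finset ℕ} (hA : ∀ a ∈ A, a ∣ 44100) (hg : Good A) : Cap (A.image vv) := by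
  intro x hx y hy z hz h
  obtain ⟨a, ha, rfl⟩ := Finset.mem_image.1 hx
  obtain ⟨b, hb, rfl⟩ := Finset.mem_image.1 hy
  obtain ⟨c, hc, rfl⟩ := Finset.mem_image.1 hz
  have key : ∀ p, (ee p a : ZMod 3) + ee p b + ee p c = 0 → 3 ∣ ee p a + ee p b + ee p c := by
    intro p hp
    rw [← ZMod.natCast_eq_zero_iff]
    push_cast
    exact hp
  have h0 := key 2 (congrFun h 0)
  have h1 := key 3 (congrFun h 1)
  have h2 := key 5 (congrFun h 2)
  have h3 := key 7 (congrFun h 3)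
  obtain ⟨w, hw, he⟩ := cube_of_ee (hA a ha) (hA b hb) (hA c hc) (by
    simp only [pr4, List.mem_cons, List.not_mem_nil, or_false, forall_eq_or_imp, forall_eq]
    exact ⟨h0, h1, h2, h3⟩)
  obtain ⟨e1, e2⟩ := hg a ha b hb c hc w hw he
  rw [e1, e2]; exact ⟨rfl, rfl⟩

lemma card20 {A : Finset ℕ} (hA : ∀ a ∈ A, a ∣ 44100) (hg : Good A) : A.card ≤ 20 := by
  rw [← Finset.card_image_of_injOn (vv_inj hA)]
  exact cap4 _ (vv_cap hA hg)

lemma card9 {A : Finset ℕ} (hA : ∀ a ∈ A, a ∣ 44100) (hg : Good A) (u : VV 4) (hu : u ≠ 0)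
    (F : List ℕ) (hF : ∀ a ∈ F, u ⬝ᵥ vv a = 0) : (A.filter (· ∈ F)).card ≤ 9 := by
  refine le_trans ?_ (sl_card_le cap3 (vv_cap hA hg) hu 0)
  rw [← Finset.card_image_of_injOn ((vv_inj hA).mono (Finset.filter_subset (· ∈ F) A))]
  apply Finset.card_le_card
  intro x hx
  obtain ⟨a, ha, rfl⟩ := Finset.mem_image.1 hx
  rw [Finset.mem_filter] at ha
  exact Finset.mem_filter.2 ⟨Finset.mem_image_of_mem _ ha.1, hF a ha.2⟩

def okF (F : List ℕ) (m : ℕ) : Bool :=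
  (Nat.beq m 9 && F.all fun a => Nat.beq (ee 7 a) 0) ||
    ((Nat.beq m 9 && F.all fun a => Nat.beq (ee 5 a) 0) || srch 200 [] (F.map cd) (m + 1))

lemma okF_sound {A : Finset ℕ} (hA : ∀ a ∈ A, a ∣ 44100) (hg : Good A) (F : List ℕ) (m : ℕ)
    (h : okF F m = true) : (A.filter (· ∈ F)).card ≤ m := by
  unfold okF at h
  rw [Bool.or_eq_true, Bool.or_eq_true, Bool.and_eq_true, Bool.and_eq_true] at h
  rcases h with ⟨h1, h2⟩ | ⟨h1, h2⟩ | h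
  · rw [Nat.beq_eq] at h1
    rw [h1]
    refine card9 hA hg ![0, 0, 0, 1] (by decide) F ?_
    intro a ha
    have := List.all_eq_true.1 h2 a ha
    rw [Nat.beq_eq] at this
    simp [vv, this, dotProduct, Fin.sum_univ_four]
  · rw [Nat.beq_eq] at h1
    rw [h1]
    refine card9 hA hg ![0, 0, 1, 0] (by decide) F ?_
    intro a ha
    have := List.all_eq_true.1 h2 a ha
    rw [Nat.beq_eq] at this
    simp [vv, this, dotProduct, Fin.sum_univ_four]
  · exact srch_card hA hg F m h

def divL : List ℕ := (List.range 211).filter fun a => Nat.beq (44100 % a) 0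

def cert (W y k : ℕ) (C : List (ℕ × ℕ × List ℕ)) : Bool :=
  Nat.blt ((C.map fun c => c.1 * c.2.1).sum) (W * (k + 1)) &&
  ((divL.all fun a => Nat.blt y a ||
    Nat.ble W ((C.map fun c => bif c.2.2.elem a then c.1 else 0).sum)) &&
  C.all fun c => okF c.2.2 c.2.1)

lemma cert_sum (A : Finset ℕ) (C : List (ℕ × ℕ × List ℕ)) :
    ∑ a ∈ A, (C.map fun c => bif c.2.2.elem a then c.1 else 0).sum =
      (C.map fun c => c.1 * (A.filter (· ∈ c.2.2)).card).sum := by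
  induction C with
  | nil => simp
  | cons c C ih =>
    simp only [List.map_cons, List.sum_cons, Finset.sum_add_distrib, ih]
    congr 1
    rw [Finset.card_filter, Finset.mul_sum]
    refine Finset.sum_congr rfl fun a _ => ?_
    by_cases h : a ∈ c.2.2 <;> simp [h]

lemma cert_sound {A : Finset ℕ} (hA : ∀ a ∈ A, a ∣ 44100) (hg : Good A) {W y k : ℕ}
    {C : List (ℕ × ℕ × List ℕ)} (hy : y ≤ 210) (hAy : ∀ a ∈ A, a ≤ y)
    (h : cert W y k C = true) : A.card ≤ k := by
  unfold cert at h
  rw [Bool.and_eq_true, Bool.and_eq_true] at h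
  obtain ⟨h1, h2, h3⟩ := h
  have h1' : (C.map fun c => c.1 * c.2.1).sum < W * (k + 1) := by simpa [Nat.blt] using h1
  have h4 : ∑ a ∈ A, W ≤ ∑ a ∈ A, (C.map fun c => bif c.2.2.elem a then c.1 else 0).sum := by
    refine Finset.sum_le_sum fun a ha => ?_
    have hm : a ∈ divL := by
      unfold divL
      rw [List.mem_filter, List.mem_range, Nat.beq_eq]
      exact ⟨by have := hAy a ha; omega, Nat.mod_eq_zero_of_dvd (hA a ha)⟩
    have := List.all_eq_true.1 h2 a hm
    rw [Bool.or_eq_true] at this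
    rcases this with h | h
    · have h' : y < a := by simpa [Nat.blt] using h
      have := hAy a ha
      omega
    · exact Nat.le_of_ble_eq_true h
  rw [cert_sum, Finset.sum_const, smul_eq_mul] at h4
  have h5 : (C.map fun c => c.1 * (A.filter (· ∈ c.2.2)).card).sum ≤
      (C.map fun c => c.1 * c.2.1).sum := by
    apply List.sum_le_sum
    intro c hc
    exact Nat.mul_le_mul_left _ (okF_sound hA hg _ _ (List.all_eq_true.1 h3 c hc))
  by_contra hk
  have : W * (k + 1) ≤ A.card * W := by
    rw [mul_comm]; exact Nat.mul_le_mul_right _ (by omega)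
  omega

lemma ub0 {A : Finset ℕ} (hA : ∀ a ∈ A, a ∣ 44100) (hg : Good A)
    (hy : ∀ a ∈ A, a < 1) : A.card ≤ 0 := by
  refine cert_sound hA hg (W := 1) (y := 0) (k := 0) (C := [])
    (by norm_num) (fun a ha => Nat.le_of_lt_succ (hy a ha)) ?_
  decide +kernel

lemma ub1 {A : Finset ℕ} (hA : ∀ a ∈ A, a ∣ 44100) (hg : Good A)
    (hy : ∀ a ∈ A, a < 2) : A.card ≤ 1 := by
  refine cert_sound hA hg (W := 1) (y := 1) (k := 1) (C := [(1, 1, [1])])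
    (by norm_num) (fun a ha => Nat.le_of_lt_succ (hy a ha)) ?_
  decide +kernel

lemma ub2 {A : Finset ℕ} (hA : ∀ a ∈ A, a ∣ 44100) (hg : Good A)
    (hy : ∀ a ∈ A, a < 3) : A.card ≤ 2 := by
  refine cert_sound hA hg (W := 1) (y := 2) (k := 2) (C := [(1, 1, [1]),
    (1, 1, [2])])
    (by norm_num) (fun a ha => Nat.le_of_lt_succ (hy a ha)) ?_
  decide +kernel

lemma ub3 {A : Finset ℕ} (hA : ∀ a ∈ A, a ∣ 44100) (hg : Good A)
    (hy : ∀ a ∈ A, a < 5) : A.card ≤ 3 := by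
  refine cert_sound hA hg (W := 1) (y := 4) (k := 3) (C := [(1, 3, [1, 2, 3, 4])])
    (by norm_num) (fun a ha => Nat.le_of_lt_succ (hy a ha)) ?_
  decide +kernel

lemma ub4 {A : Finset ℕ} (hA : ∀ a ∈ A, a ∣ 44100) (hg : Good A)
    (hy : ∀ a ∈ A, a < 6) : A.card ≤ 4 := by
  refine cert_sound hA hg (W := 1) (y := 5) (k := 4) (C := [(1, 3, [1, 2, 3, 4]),
    (1, 1, [5])])
    (by norm_num) (fun a ha => Nat.le_of_lt_succ (hy a ha)) ?_
  decide +kernel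

lemma ub5 {A : Finset ℕ} (hA : ∀ a ∈ A, a ∣ 44100) (hg : Good A)
    (hy : ∀ a ∈ A, a < 7) : A.card ≤ 5 := by
  refine cert_sound hA hg (W := 1) (y := 6) (k := 5) (C := [(1, 3, [1, 2, 3, 4]),
    (1, 1, [5]),
    (1, 1, [6])])
    (by norm_num) (fun a ha => Nat.le_of_lt_succ (hy a ha)) ?_
  decide +kernel

lemma ub6 {A : Finset ℕ} (hA : ∀ a ∈ A, a ∣ 44100) (hg : Good A)
    (hy : ∀ a ∈ A, a < 10) : A.card ≤ 6 := by
  refine cert_sound hA hg (W := 1) (y := 9) (k := 6) (C := [(1, 6, [1, 2, 3, 4, 5, 6, 7, 9])])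
    (by norm_num) (fun a ha => Nat.le_of_lt_succ (hy a ha)) ?_
  decide +kernel

lemma ub7 {A : Finset ℕ} (hA : ∀ a ∈ A, a ∣ 44100) (hg : Good A)
    (hy : ∀ a ∈ A, a < 14) : A.card ≤ 7 := by
  refine cert_sound hA hg (W := 1) (y := 13) (k := 7) (C := [(1, 6, [1, 2, 3, 4, 5, 6, 9, 10, 12]),
    (1, 1, [7])])
    (by norm_num) (fun a ha => Nat.le_of_lt_succ (hy a ha)) ?_
  decide +kernel

lemma ub8 {A : Finset ℕ} (hA : ∀ a ∈ A, a ∣ 44100) (hg : Good A)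
    (hy : ∀ a ∈ A, a < 15) : A.card ≤ 8 := by
  refine cert_sound hA hg (W := 1) (y := 14) (k := 8) (C := [(1, 6, [1, 2, 3, 4, 5, 6, 9, 10, 12]),
    (1, 1, [7]),
    (1, 1, [14])])
    (by norm_num) (fun a ha => Nat.le_of_lt_succ (hy a ha)) ?_
  decide +kernel

lemma ub9 {A : Finset ℕ} (hA : ∀ a ∈ A, a ∣ 44100) (hg : Good A)
    (hy : ∀ a ∈ A, a < 21) : A.card ≤ 9 := by
  refine cert_sound hA hg (W := 1) (y := 20) (k := 9) (C := [(1, 6, [1, 2, 3, 4, 6, 7, 9, 12, 14, 18]),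
    (1, 3, [5, 10, 15, 20])])
    (by norm_num) (fun a ha => Nat.le_of_lt_succ (hy a ha)) ?_
  decide +kernel

lemma ub10 {A : Finset ℕ} (hA : ∀ a ∈ A, a ∣ 44100) (hg : Good A)
    (hy : ∀ a ∈ A, a < 25) : A.card ≤ 10 := by
  refine cert_sound hA hg (W := 1) (y := 24) (k := 10) (C := [(1, 6, [1, 2, 3, 4, 6, 7, 9, 12, 14, 18]),
    (1, 3, [5, 10, 15, 20]),
    (1, 1, [21])])
    (by norm_num) (fun a ha => Nat.le_of_lt_succ (hy a ha)) ?_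
  decide +kernel

lemma ub11 {A : Finset ℕ} (hA : ∀ a ∈ A, a ∣ 44100) (hg : Good A)
    (hy : ∀ a ∈ A, a < 30) : A.card ≤ 11 := by
  refine cert_sound hA hg (W := 3) (y := 29) (k := 11) (C := [(2, 4, [1, 2, 3, 4, 6, 9, 12, 18]),
    (1, 5, [1, 2, 4, 5, 10, 20, 21, 25]),
    (1, 2, [3, 6, 12]),
    (2, 6, [5, 7, 10, 14, 15, 20, 21, 28]),
    (1, 3, [7, 14, 25, 28]),
    (1, 3, [9, 15, 18, 25])])
    (by norm_num) (fun a ha => Nat.le_of_lt_succ (hy a ha)) ?_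
  decide +kernel

lemma ub12 {A : Finset ℕ} (hA : ∀ a ∈ A, a ∣ 44100) (hg : Good A)
    (hy : ∀ a ∈ A, a < 35) : A.card ≤ 12 := by
  refine cert_sound hA hg (W := 3) (y := 34) (k := 12) (C := [(2, 4, [1, 2, 3, 4, 6, 9, 12, 18]),
    (1, 5, [1, 2, 4, 5, 10, 20, 21, 25]),
    (1, 2, [3, 6, 12]),
    (2, 6, [5, 7, 10, 14, 15, 20, 21, 28]),
    (1, 3, [7, 14, 25, 28]),
    (1, 3, [9, 15, 18, 25]),
    (3, 1, [30])])
    (by norm_num) (fun a ha => Nat.le_of_lt_succ (hy a ha)) ?_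
  decide +kernel

lemma ub13 {A : Finset ℕ} (hA : ∀ a ∈ A, a ∣ 44100) (hg : Good A)
    (hy : ∀ a ∈ A, a < 42) : A.card ≤ 13 := by
  refine cert_sound hA hg (W := 3) (y := 41) (k := 13) (C := [(2, 9, [1, 2, 3, 4, 5, 6, 9, 10, 12, 15, 18, 20, 25, 30, 36]),
    (1, 7, [1, 2, 3, 4, 6, 7, 9, 12, 14, 18, 21, 28, 36]),
    (1, 7, [5, 7, 10, 14, 15, 20, 21, 28, 30]),
    (1, 4, [7, 14, 21, 25, 28]),
    (3, 1, [35])])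
    (by norm_num) (fun a ha => Nat.le_of_lt_succ (hy a ha)) ?_
  decide +kernel

lemma ub14 {A : Finset ℕ} (hA : ∀ a ∈ A, a ∣ 44100) (hg : Good A)
    (hy : ∀ a ∈ A, a < 60) : A.card ≤ 14 := by
  refine cert_sound hA hg (W := 16) (y := 59) (k := 14) (C := [(8, 9, [1, 2, 3, 4, 5, 6, 9, 10, 12, 15, 18, 20, 25, 30, 36, 45, 50]),
    (2, 4, [1, 2, 3, 4, 6, 9, 12, 18, 36]),
    (2, 4, [1, 2, 4, 5, 10, 20, 25, 50]),
    (2, 4, [1, 2, 4, 7, 14, 28, 49]),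
    (2, 4, [1, 12, 18, 20, 30, 45, 50]),
    (1, 3, [2, 10, 21, 50]),
    (1, 3, [2, 10, 42, 50]),
    (2, 3, [3, 4, 18, 35]),
    (4, 4, [3, 6, 7, 12, 14, 28]),
    (3, 8, [5, 7, 10, 14, 15, 20, 21, 28, 30, 42, 45]),
    (1, 5, [5, 10, 15, 20, 30, 35, 45]),
    (2, 2, [5, 15, 45]),
    (2, 3, [6, 25, 35, 49]),
    (6, 5, [7, 14, 21, 28, 35, 42]),
    (1, 3, [7, 14, 28, 35]),
    (2, 7, [9, 15, 18, 21, 25, 30, 35, 36, 42, 49, 50]),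
    (4, 2, [9, 21, 49]),
    (2, 2, [25, 35, 49]),
    (4, 2, [36, 42, 49])])
    (by norm_num) (fun a ha => Nat.le_of_lt_succ (hy a ha)) ?_
  decide +kernel

lemma ub15 {A : Finset ℕ} (hA : ∀ a ∈ A, a ∣ 44100) (hg : Good A)
    (hy : ∀ a ∈ A, a < 70) : A.card ≤ 15 := by
  refine cert_sound hA hg (W := 2) (y := 69) (k := 15) (C := [(1, 9, [1, 2, 3, 4, 5, 6, 9, 10, 12, 15, 18, 20, 25, 30, 36, 45, 50, 60]),
    (1, 9, [1, 2, 3, 4, 6, 7, 9, 12, 14, 18, 21, 28, 36, 42, 49, 63]),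
    (1, 5, [5, 10, 15, 20, 30, 35, 45, 60]),
    (1, 4, [7, 14, 21, 28, 42, 63]),
    (1, 3, [25, 35, 49, 50])])
    (by norm_num) (fun a ha => Nat.le_of_lt_succ (hy a ha)) ?_
  decide +kernel

lemma ub16 {A : Finset ℕ} (hA : ∀ a ∈ A, a ∣ 44100) (hg : Good A)
    (hy : ∀ a ∈ A, a < 105) : A.card ≤ 16 := by
  refine cert_sound hA hg (W := 2) (y := 104) (k := 16) (C := [(1, 9, [1, 2, 3, 4, 5, 6, 9, 10, 12, 15, 18, 20, 25, 30, 36, 45, 50, 60, 75, 90, 100]),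
    (1, 9, [1, 2, 3, 4, 6, 7, 9, 12, 14, 18, 21, 28, 36, 42, 49, 63, 84, 98]),
    (1, 4, [5, 10, 15, 20, 30, 45, 60, 90]),
    (1, 6, [7, 14, 21, 28, 35, 42, 63, 70, 84]),
    (1, 4, [25, 35, 49, 50, 70, 98, 100]),
    (1, 1, [75])])
    (by norm_num) (fun a ha => Nat.le_of_lt_succ (hy a ha)) ?_
  decide +kernel

lemma ub17 {A : Finset ℕ} (hA : ∀ a ∈ A, a ∣ 44100) (hg : Good A)
    (hy : ∀ a ∈ A, a < 150) : A.card ≤ 17 := by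
  refine cert_sound hA hg (W := 2) (y := 149) (k := 17) (C := [(1, 9, [1, 2, 3, 4, 5, 6, 9, 10, 12, 15, 18, 20, 25, 30, 36, 45, 50, 60, 75, 90, 100]),
    (1, 9, [1, 2, 3, 4, 6, 7, 9, 12, 14, 18, 21, 28, 36, 42, 49, 63, 84, 98, 126, 147]),
    (1, 8, [5, 7, 10, 14, 15, 20, 21, 28, 30, 42, 45, 60, 63, 84, 90, 126]),
    (1, 6, [25, 35, 49, 50, 70, 75, 98, 100, 105, 140, 147]),
    (1, 3, [35, 70, 105, 140])])
    (by norm_num) (fun a ha => Nat.le_of_lt_succ (hy a ha)) ?_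
  decide +kernel

lemma ub18 {A : Finset ℕ} (hA : ∀ a ∈ A, a ∣ 44100) (hg : Good A)
    (hy : ∀ a ∈ A, a < 175) : A.card ≤ 18 := by
  refine cert_sound hA hg (W := 2) (y := 174) (k := 18) (C := [(1, 9, [1, 2, 3, 4, 5, 6, 9, 10, 12, 15, 18, 20, 25, 30, 36, 45, 50, 60, 75, 90, 100]),
    (1, 9, [1, 2, 3, 4, 6, 7, 9, 12, 14, 18, 21, 28, 36, 42, 49, 63, 84, 98, 126, 147]),
    (1, 8, [5, 7, 10, 14, 15, 20, 21, 28, 30, 42, 45, 60, 63, 84, 90, 126]),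
    (1, 6, [25, 35, 49, 50, 70, 75, 98, 100, 105, 140, 147]),
    (1, 3, [35, 70, 105, 140]),
    (2, 1, [150])])
    (by norm_num) (fun a ha => Nat.le_of_lt_succ (hy a ha)) ?_
  decide +kernel

lemma ub19 {A : Finset ℕ} (hA : ∀ a ∈ A, a ∣ 44100) (hg : Good A)
    (hy : ∀ a ∈ A, a < 210) : A.card ≤ 19 := by
  refine cert_sound hA hg (W := 6) (y := 209) (k := 19) (C := [(3, 9, [1, 2, 3, 4, 5, 6, 9, 10, 12, 15, 18, 20, 25, 30, 36, 45, 50, 60, 75, 90, 100, 150, 180]),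
    (3, 9, [1, 2, 3, 4, 6, 7, 9, 12, 14, 18, 21, 28, 36, 42, 49, 63, 84, 98, 126, 147, 196]),
    (2, 8, [5, 7, 10, 14, 15, 20, 21, 28, 30, 42, 45, 60, 63, 84, 90, 126, 180]),
    (1, 7, [5, 10, 15, 20, 30, 35, 45, 60, 70, 90, 105, 140, 180]),
    (1, 4, [7, 14, 28, 35, 70, 140, 175]),
    (1, 4, [21, 35, 42, 70, 84, 140]),
    (3, 7, [25, 35, 49, 50, 70, 75, 98, 100, 105, 140, 147, 150, 196]),
    (2, 2, [63, 105, 175]),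
    (1, 1, [126]),
    (3, 1, [175])])
    (by norm_num) (fun a ha => Nat.le_of_lt_succ (hy a ha)) ?_
  decide +kernel

def TU : Finset ℕ :=
  {1, 2, 3, 5, 6, 7, 10, 14, 15, 21, 25, 30, 35, 42, 60, 70, 105, 150, 175, 210}

def TL : Finset ℕ :=
  {1, 2, 3, 5, 6, 7, 10, 14, 15, 21, 25, 30, 35, 42, 60, 70, 105, 175, 210, 315}

lemma stp_mono (S : Finset ℕ) (j : ℕ → ℕ) {x y : ℕ} (h : x ≤ y) : stp S j x ≤ stp S j y := by
  unfold stp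
  refine Finset.sum_le_sum fun s _ => ?_
  split_ifs <;> omega

lemma ub_stp (y : ℕ) : gN 210 y ≤ stp TU (fun _ => 1) y := by
  obtain ⟨A, hA, hy, hg, hc⟩ := gN_attain 210 y
  rw [← hc]
  have hA' : ∀ a ∈ A, a ∣ 44100 := fun a ha => Nat.dvd_of_mem_divisors (hA ha)
  have step : ∀ lo hi k : ℕ, stp TU (fun _ => 1) lo = k → ((∀ a ∈ A, a < hi) → A.card ≤ k) →
      lo ≤ y → y < hi → A.card ≤ stp TU (fun _ => 1) y := by
    intro lo hi k h1 h2 h3 h4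
    exact (h2 fun a ha => lt_of_le_of_lt (hy a ha) h4).trans (h1 ▸ stp_mono _ _ h3)
  by_cases h0 : y < 1
  · exact step 0 1 0 (by decide +kernel) (ub0 hA' hg) (by omega) h0
  by_cases h1 : y < 2
  · exact step 1 2 1 (by decide +kernel) (ub1 hA' hg) (by omega) h1
  by_cases h2 : y < 3
  · exact step 2 3 2 (by decide +kernel) (ub2 hA' hg) (by omega) h2
  by_cases h3 : y < 5
  · exact step 3 5 3 (by decide +kernel) (ub3 hA' hg) (by omega) h3
  by_cases h4 : y < 6
  · exact step 5 6 4 (by decide +kernel) (ub4 hA' hg) (by omega) h4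
  by_cases h5 : y < 7
  · exact step 6 7 5 (by decide +kernel) (ub5 hA' hg) (by omega) h5
  by_cases h6 : y < 10
  · exact step 7 10 6 (by decide +kernel) (ub6 hA' hg) (by omega) h6
  by_cases h7 : y < 14
  · exact step 10 14 7 (by decide +kernel) (ub7 hA' hg) (by omega) h7
  by_cases h8 : y < 15
  · exact step 14 15 8 (by decide +kernel) (ub8 hA' hg) (by omega) h8
  by_cases h9 : y < 21
  · exact step 15 21 9 (by decide +kernel) (ub9 hA' hg) (by omega) h9
  by_cases h10 : y < 25
  · exact step 21 25 10 (by decide +kernel) (ub10 hA' hg) (by omega) h10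
  by_cases h11 : y < 30
  · exact step 25 30 11 (by decide +kernel) (ub11 hA' hg) (by omega) h11
  by_cases h12 : y < 35
  · exact step 30 35 12 (by decide +kernel) (ub12 hA' hg) (by omega) h12
  by_cases h13 : y < 42
  · exact step 35 42 13 (by decide +kernel) (ub13 hA' hg) (by omega) h13
  by_cases h14 : y < 60
  · exact step 42 60 14 (by decide +kernel) (ub14 hA' hg) (by omega) h14
  by_cases h15 : y < 70
  · exact step 60 70 15 (by decide +kernel) (ub15 hA' hg) (by omega) h15
  by_cases h16 : y < 105
  · exact step 70 105 16 (by decide +kernel) (ub16 hA' hg) (by omega) h16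
  by_cases h17 : y < 150
  · exact step 105 150 17 (by decide +kernel) (ub17 hA' hg) (by omega) h17
  by_cases h18 : y < 175
  · exact step 150 175 18 (by decide +kernel) (ub18 hA' hg) (by omega) h18
  by_cases h19 : y < 210
  · exact step 175 210 19 (by decide +kernel) (ub19 hA' hg) (by omega) h19
  have h : stp TU (fun _ => 1) 210 = 20 := by decide +kernel
  exact (card20 hA' hg).trans (h ▸ stp_mono _ _ (by omega))

def wit (L : List ℕ) (t k : ℕ) : Bool :=
  Nat.beq L.length k && (decide L.Nodup && ((L.all fun a => Nat.ble a t && Nat.beq (44100 % a) 0) &&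
    L.all fun a => L.all fun b => L.all fun c =>
      !(col (cd a + cd b + cd c)) || (Nat.beq a b && Nat.beq b c)))

lemma wit_sound {L : List ℕ} {t k : ℕ} (h : wit L t k = true) {y : ℕ} (hy : t ≤ y) :
    k ≤ gN 210 y := by
  unfold wit at h
  simp only [Bool.and_eq_true, Nat.beq_eq, decide_eq_true_eq, List.all_eq_true] at h
  obtain ⟨h1, h2, h3, h4⟩ := h
  have hd : ∀ a ∈ L, a ∣ 44100 := fun a ha => Nat.dvd_of_mod_eq_zero (h3 a ha).2
  rw [← h1, ← List.toFinset_card_of_nodup h2]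
  refine gN_ge ?_ ?_ ?_
  · intro a ha
    rw [Nat.mem_divisors]
    exact ⟨hd a (List.mem_toFinset.1 ha), by norm_num⟩
  · intro a ha
    exact (Nat.le_of_ble_eq_true (h3 a (List.mem_toFinset.1 ha)).1).trans hy
  · intro a ha b hb c hc x _ hx
    rw [List.mem_toFinset] at ha hb hc
    have hc' := (col_iff a b c).2 (ee_of_cube (hd a ha) (hd b hb) (hd c hc) hx)
    have := h4 a ha b hb c hc
    rw [hc'] at this
    simpa using this

lemma lb_stp (y : ℕ) : stp TL (fun _ => 1) y ≤ gN 210 y := by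
  have step : ∀ hi k : ℕ, stp TL (fun _ => 1) hi = k → k ≤ gN 210 y → y ≤ hi →
      stp TL (fun _ => 1) y ≤ gN 210 y := by
    intro hi k h1 h2 h3
    exact (stp_mono _ _ h3).trans (h1 ▸ h2)
  by_cases h0 : y < 1
  · exact step 0 0 (by decide +kernel) (Nat.zero_le _) (by omega)
  by_cases h1 : y < 2
  · exact step 1 1 (by decide +kernel) (wit_sound (L := [1])
      (t := 1) (by decide +kernel) (by omega)) (by omega)
  by_cases h2 : y < 3
  · exact step 2 2 (by decide +kernel) (wit_sound (L := [2, 1])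
      (t := 2) (by decide +kernel) (by omega)) (by omega)
  by_cases h3 : y < 5
  · exact step 4 3 (by decide +kernel) (wit_sound (L := [3, 2, 1])
      (t := 3) (by decide +kernel) (by omega)) (by omega)
  by_cases h4 : y < 6
  · exact step 5 4 (by decide +kernel) (wit_sound (L := [5, 4, 3, 2])
      (t := 5) (by decide +kernel) (by omega)) (by omega)
  by_cases h5 : y < 7
  · exact step 6 5 (by decide +kernel) (wit_sound (L := [6, 5, 4, 3, 2])
      (t := 6) (by decide +kernel) (by omega)) (by omega)
  by_cases h6 : y < 10
  · exact step 9 6 (by decide +kernel) (wit_sound (L := [7, 6, 5, 4, 3, 2])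
      (t := 7) (by decide +kernel) (by omega)) (by omega)
  by_cases h7 : y < 14
  · exact step 13 7 (by decide +kernel) (wit_sound (L := [10, 9, 7, 6, 5, 3, 2])
      (t := 10) (by decide +kernel) (by omega)) (by omega)
  by_cases h8 : y < 15
  · exact step 14 8 (by decide +kernel) (wit_sound (L := [14, 12, 10, 9, 7, 6, 5, 1])
      (t := 14) (by decide +kernel) (by omega)) (by omega)
  by_cases h9 : y < 21
  · exact step 20 9 (by decide +kernel) (wit_sound (L := [15, 14, 12, 10, 9, 7, 6, 5, 1])
      (t := 15) (by decide +kernel) (by omega)) (by omega)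
  by_cases h10 : y < 25
  · exact step 24 10 (by decide +kernel) (wit_sound (L := [21, 20, 18, 15, 14, 12, 10, 9, 7, 6])
      (t := 21) (by decide +kernel) (by omega)) (by omega)
  by_cases h11 : y < 30
  · exact step 29 11 (by decide +kernel) (wit_sound (L := [25, 21, 20, 18, 15, 14, 12, 7, 6, 5, 4])
      (t := 25) (by decide +kernel) (by omega)) (by omega)
  by_cases h12 : y < 35
  · exact step 34 12 (by decide +kernel) (wit_sound (L := [30, 28, 25, 21, 20, 18, 15, 14, 12, 6, 5, 4])
      (t := 30) (by decide +kernel) (by omega)) (by omega)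
  by_cases h13 : y < 42
  · exact step 41 13 (by decide +kernel) (wit_sound (L := [35, 30, 28, 25, 21, 20, 18, 15, 14, 12, 6, 5, 4])
      (t := 35) (by decide +kernel) (by omega)) (by omega)
  by_cases h14 : y < 60
  · exact step 59 14 (by decide +kernel) (wit_sound (L := [42, 35, 30, 28, 25, 21, 20, 18, 15, 14, 12, 6, 5, 4])
      (t := 42) (by decide +kernel) (by omega)) (by omega)
  by_cases h15 : y < 70
  · exact step 69 15 (by decide +kernel) (wit_sound (L := [60, 50, 49, 42, 35, 28, 21, 20, 18, 15, 12, 10, 7, 6, 4])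
      (t := 60) (by decide +kernel) (by omega)) (by omega)
  by_cases h16 : y < 105
  · exact step 104 16 (by decide +kernel) (wit_sound (L := [70, 60, 50, 49, 42, 35, 28, 21, 20, 18, 15, 12, 10, 7, 6, 4])
      (t := 70) (by decide +kernel) (by omega)) (by omega)
  by_cases h17 : y < 175
  · exact step 174 17 (by decide +kernel) (wit_sound (L := [105, 98, 90, 84, 75, 70, 63, 45, 36, 35, 30, 28, 18, 7, 6, 5, 3])
      (t := 105) (by decide +kernel) (by omega)) (by omega)
  by_cases h18 : y < 210
  · exact step 209 18 (by decide +kernel) (wit_sound (L := [175, 150, 140, 126, 105, 98, 70, 45, 42, 30, 21, 12, 10, 7, 5, 3, 2, 1])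
      (t := 175) (by decide +kernel) (by omega)) (by omega)
  by_cases h19 : y < 315
  · exact step 314 19 (by decide +kernel) (wit_sound (L := [210, 196, 180, 175, 140, 126, 105, 75, 70, 42, 21, 20, 15, 12, 7, 6, 5, 4, 1])
      (t := 210) (by decide +kernel) (by omega)) (by omega)
  have h : stp TL (fun _ => 1) y ≤ 20 := by
    unfold stp
    refine (Finset.sum_le_card_nsmul _ _ 1 ?_).trans (by decide)
    intro s _
    dsimp only
    split_ifs <;> omega
  exact h.trans (wit_sound (L := [315, 252, 245, 180, 175, 140, 126, 105, 90, 84, 70, 60, 49, 42, 30, 25, 9, 4, 3, 2])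
    (t := 315) (by decide +kernel) (by omega))

lemma upper_c {c : ℝ} (hc : Tendsto (fun n : ℕ => (fkd 3 3 n : ℝ) / n) atTop (nhds c)) :
    c ≤ 0.6420 := by
  set d : ℕ → ℕ := fun p => if p ≤ 7 then p else p ^ 3 with hd
  set I : Finset ℕ := {2, 3, 5, 7, 11, 13} with hI
  have h1 := tendsto_stp TU (fun _ => 1) (by decide) I d (by decide) (by decide)
  have h2 : c ≤ _ := le_of_tendsto_of_tendsto hc h1 (by
    refine Eventually.of_forall fun n => ?_
    dsimp only
    gcongr
    refine (upper 210 (by norm_num) I d ?_ n).trans ?_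
    · intro p hp
      simp only [hI, Finset.mem_insert, Finset.mem_singleton] at hp
      rcases hp with rfl | rfl | rfl | rfl | rfl | rfl
      · left; norm_num [hd]
      · left; norm_num [hd]
      · left; norm_num [hd]
      · left; norm_num [hd]
      · right; exact ⟨11, by norm_num, by norm_num [hd]⟩
      · right; exact ⟨13, by norm_num, by norm_num [hd]⟩
    · exact Finset.sum_le_sum fun r _ => ub_stp _)
  refine h2.trans ?_
  have e1 : ∏ p ∈ I, (1 - 1 / (d p : ℝ)) = 8 / 35 * (1 - 1 / 1331) * (1 - 1 / 2197) := by
    norm_num [hI, hd]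
  rw [e1]
  norm_num [TU]

lemma euler2 : Tendsto (fun n : ℕ => ∏ p ∈ n.primesBelow, (1 - 1 / (p : ℝ) ^ 2)) atTop
    (nhds (6 / Real.pi ^ 2)) := by
  have h := riemannZeta_eulerProduct (s := 2) (by norm_num)
  rw [riemannZeta_two] at h
  have h1 := (Complex.continuous_re.tendsto _).comp h
  have e1 : ((Real.pi : ℂ) ^ 2 / 6).re = Real.pi ^ 2 / 6 := by
    have : ((Real.pi : ℂ) ^ 2 / 6) = ((Real.pi ^ 2 / 6 : ℝ) : ℂ) := by push_cast; rfl
    rw [this, Complex.ofReal_re]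
  rw [e1] at h1
  have h2 := h1.inv₀ (by positivity)
  have e2 : (Real.pi ^ 2 / 6)⁻¹ = 6 / Real.pi ^ 2 := by rw [inv_div]
  rw [e2] at h2
  refine h2.congr fun n => ?_
  simp only [Function.comp]
  have : ∏ p ∈ n.primesBelow, (1 - (p : ℂ) ^ (-(2 : ℂ)))⁻¹ =
      ((∏ p ∈ n.primesBelow, (1 - 1 / (p : ℝ) ^ 2) : ℝ)⁻¹ : ℝ) := by
    rw [Finset.prod_inv_distrib]
    push_cast
    congr 1
    refine Finset.prod_congr rfl fun p _ => ?_
    rw [Complex.cpow_neg]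
    norm_num
  rw [this, Complex.ofReal_re, inv_inv]

lemma lower_Q {c : ℝ} (hc : Tendsto (fun n : ℕ => (fkd 3 3 n : ℝ) / n) atTop (nhds c))
    (Q : ℕ) (hQ : 7 ≤ Q) : (∑ s ∈ TL, (1 : ℝ) / s) * ((8 / 35) / (3 / 4 * (8 / 9) * (24 / 25) * (48 / 49)) *
      ∏ p ∈ (Q + 1).primesBelow, (1 - 1 / (p : ℝ) ^ 2)) - 1 / Q ≤ c := by
  set d : ℕ → ℕ := fun p => if p ≤ 7 then p else p ^ 2 with hd
  set I : Finset ℕ := (Q + 1).primesBelow with hI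
  have hpr : ∀ p ∈ I, p.Prime := fun p hp => Nat.prime_of_mem_primesBelow hp
  have hdp : ∀ p, d p = p ∨ d p = p ^ 2 := by
    intro p
    by_cases h : p ≤ 7
    · left; simp [hd, h]
    · right; simp [hd, h]
  have h1 := tendsto_stp TL (fun _ => 1) (by decide) I d (by
    intro p hp
    have := (hpr p hp).pos
    rcases hdp p with h | h <;> rw [h] <;> positivity) (by
    intro p hp q hq hpq
    have := (Nat.coprime_primes (hpr p hp) (hpr q hq)).2 hpq
    rcases hdp p with h | h <;> rcases hdp q with h' | h' <;> rw [h, h']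
    · exact this
    · exact Nat.Coprime.pow_right _ this
    · exact Nat.Coprime.pow_left _ this
    · exact Nat.Coprime.pow _ _ this)
  have h2 := hc.add (tendsto_const_nhds (x := (1 : ℝ) / Q))
  have h3 := le_of_tendsto_of_tendsto h1 h2 (by
    filter_upwards [eventually_gt_atTop 0] with n hn
    have hn' : (0 : ℝ) < n := by exact_mod_cast hn
    have hb := bad_count Q n (by omega)
    have hl := lower 210 Q (by norm_num) I d (by
      intro r hr
      constructor
      · have key : ∀ p : ℕ, p.Prime → p ≤ 7 → Nat.Coprime r p := by
          intro p hp h7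
          have := hr p (Nat.mem_primesBelow.2 ⟨by omega, hp⟩)
          have e : d p = p := by simp [hd, h7]
          rw [e] at this
          exact ((Nat.Prime.coprime_iff_not_dvd hp).2 this).symm
        have : (210 : ℕ) = 2 * 3 * 5 * 7 := by norm_num
        rw [this]
        exact (((key 2 (by norm_num) (by norm_num)).mul_right (key 3 (by norm_num) (by norm_num))).mul_right
          (key 5 (by norm_num) (by norm_num))).mul_right (key 7 (by norm_num) (by norm_num))
      · intro p hp hpp
        by_contra hle
        have := hr p (Nat.mem_primesBelow.2 ⟨by omega, hp⟩)
        apply this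
        rcases hdp p with h | h <;> rw [h]
        · exact (Dvd.intro _ rfl).trans hpp
        · rw [pow_two]; exact hpp) n
    have h4 : ∑ r ∈ (Finset.Icc 1 n).filter (RR I d), stp TL (fun _ => 1) (n / r) ≤
        ∑ r ∈ (Finset.Icc 1 n).filter (RR I d), gN 210 (n / r) :=
      Finset.sum_le_sum fun r _ => lb_stp _
    have h5 : ((∑ r ∈ (Finset.Icc 1 n).filter (RR I d), stp TL (fun _ => 1) (n / r) : ℕ) : ℝ) ≤
        fkd 3 3 n + n / Q := by
      have := h4.trans hl
      have h6 : ((∑ r ∈ (Finset.Icc 1 n).filter (RR I d), stp TL (fun _ => 1) (n / r) : ℕ) : ℝ) ≤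
        (fkd 3 3 n : ℝ) + ((Finset.Icc 1 n).filter (fun a => ∃ m ∈ Finset.Ioc Q n, m ^ 2 ∣ a)).card := by
        exact_mod_cast this
      linarith
    calc _ ≤ ((fkd 3 3 n : ℝ) + n / Q) / n := by gcongr
      _ = _ := by field_simp)
  have hsub : ({2, 3, 5, 7} : Finset ℕ) ⊆ I := by
    intro p hp
    simp only [Finset.mem_insert, Finset.mem_singleton] at hp
    rw [hI, Nat.mem_primesBelow]
    rcases hp with rfl | rfl | rfl | rfl <;> exact ⟨by omega, by norm_num⟩
  have e1 : ∏ p ∈ I, (1 - 1 / (d p : ℝ)) = (8 / 35) / (3 / 4 * (8 / 9) * (24 / 25) * (48 / 49)) *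
      ∏ p ∈ I, (1 - 1 / (p : ℝ) ^ 2) := by
    rw [← Finset.prod_sdiff hsub, ← Finset.prod_sdiff (f := fun p : ℕ => 1 - 1 / (p : ℝ) ^ 2) hsub]
    have e2 : ∏ p ∈ I \ {2, 3, 5, 7}, (1 - 1 / (d p : ℝ)) =
        ∏ p ∈ I \ {2, 3, 5, 7}, (1 - 1 / (p : ℝ) ^ 2) := by
      refine Finset.prod_congr rfl fun p hp => ?_
      rw [Finset.mem_sdiff] at hp
      have : ¬ p ≤ 7 := by
        intro h7
        have hp1 := hpr p hp.1
        apply hp.2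
        interval_cases p <;> first | decide | (exfalso; revert hp1; norm_num)
      simp [hd, this]
    rw [e2]
    have e3 : ∏ p ∈ ({2, 3, 5, 7} : Finset ℕ), (1 - 1 / (d p : ℝ)) = 8 / 35 := by
      norm_num [hd]
    have e4 : ∏ p ∈ ({2, 3, 5, 7} : Finset ℕ), (1 - 1 / (p : ℝ) ^ 2) =
        3 / 4 * (8 / 9) * (24 / 25) * (48 / 49) := by
      norm_num
    rw [e3, e4]
    field_simp
  rw [e1] at h3
  push_cast at h3
  linarith

lemma lower_c {c : ℝ} (hc : Tendsto (fun n : ℕ => (fkd 3 3 n : ℝ) / n) atTop (nhds c)) :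
    0.6224 ≤ c := by
  have h1 := euler2.comp (tendsto_add_atTop_nat 1)
  have h2 : Tendsto (fun Q : ℕ => (∑ s ∈ TL, (1 : ℝ) / s) *
      ((8 / 35) / (3 / 4 * (8 / 9) * (24 / 25) * (48 / 49)) *
      ∏ p ∈ (Q + 1).primesBelow, (1 - 1 / (p : ℝ) ^ 2)) - 1 / Q) atTop
      (nhds ((∑ s ∈ TL, (1 : ℝ) / s) * ((8 / 35) / (3 / 4 * (8 / 9) * (24 / 25) * (48 / 49)) *
      (6 / Real.pi ^ 2)) - 0)) :=
    ((h1.const_mul _).const_mul _).sub tendsto_one_div_atTop_nhds_zero_nat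
  have h3 := le_of_tendsto h2 (by
    filter_upwards [eventually_ge_atTop 7] with Q hQ
    exact lower_Q hc Q hQ)
  refine le_trans ?_ h3
  have hp : Real.pi ^ 2 ≤ 3.1416 ^ 2 := by
    have := Real.pi_lt_d4
    gcongr
  have h4 : (6 : ℝ) / 3.1416 ^ 2 ≤ 6 / Real.pi ^ 2 := by
    have := Real.pi_pos
    gcongr
  have h5 : (∑ s ∈ TL, (1 : ℝ) / s) * ((8 / 35) / (3 / 4 * (8 / 9) * (24 / 25) * (48 / 49)) *
      (6 / 3.1416 ^ 2)) ≤ (∑ s ∈ TL, (1 : ℝ) / s) * ((8 / 35) / (3 / 4 * (8 / 9) * (24 / 25) * (48 / 49)) *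
      (6 / Real.pi ^ 2)) := by
    have : 0 ≤ ∑ s ∈ TL, (1 : ℝ) / s := Finset.sum_nonneg fun s _ => by positivity
    gcongr
  rw [sub_zero]
  refine le_trans ?_ h5
  norm_num [TL]

theorem stmt_3 : ∃ c : ℝ, 0.6224 ≤ c ∧ c ≤ 0.6420 ∧
    Filter.Tendsto (fun n : ℕ => (fkd 3 3 n : ℝ) / (n : ℝ)) Filter.atTop (nhds c) := by
  obtain ⟨c, hc⟩ := fkd_tendsto
  exact ⟨c, lower_c hc, upper_c hc, hc⟩
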